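/- arXiv:1606.01212 — 6 statements merged into one kernel-verified Lean document; each statement's English description precedes it below -/
import Mathlib

section
/- Let n ≥ 3 be an integer. Then the function D ↦ λ̄₂(n,D)/λ̄₁(n,D) is monotone nondecreasing on (0, π): if 0 < D₁ ≤ D₂ < π then λ̄₂(n,D₁)/λ̄₁(n,D₁) ≤ λ̄₂(n,D₂)/λ̄₁(n,D₂). -/
open Real Set

noncomputable section

/-- Rayleigh quotient of the one-dimensional model operator
`d²/ds² − (n−1)·tan(s)·d/ds` on `[−D/2, D/2]` with weight `cos^{n−1}(s)`. -/
def rayleighQ (n : ℕ) (D : ℝ) (φ : ℝ → ℝ) : ℝ :=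
  (∫ s in (-(D/2))..(D/2), deriv φ s ^ 2 * Real.cos s ^ (n-1)) /
  (∫ s in (-(D/2))..(D/2), φ s ^ 2 * Real.cos s ^ (n-1))

/-- The first model eigenvalue `λ̄₁(n,D)`: infimum of the Rayleigh quotient over
nonzero C¹ functions on `[−D/2, D/2]` vanishing at the endpoints. -/
def modelLam1 (n : ℕ) (D : ℝ) : ℝ :=
  sInf (rayleighQ n D '' {φ : ℝ → ℝ | ContDiffOn ℝ 1 φ (Set.Icc (-(D/2)) (D/2)) ∧
    (∃ s ∈ Set.Icc (-(D/2)) (D/2), φ s ≠ 0) ∧ φ (-(D/2)) = 0 ∧ φ (D/2) = 0})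

/-- The second model eigenvalue `λ̄₂(n,D)`: the same infimum restricted to odd functions. -/
def modelLam2 (n : ℕ) (D : ℝ) : ℝ :=
  sInf (rayleighQ n D '' {φ : ℝ → ℝ | ContDiffOn ℝ 1 φ (Set.Icc (-(D/2)) (D/2)) ∧
    (∃ s ∈ Set.Icc (-(D/2)) (D/2), φ s ≠ 0) ∧
    (∀ s ∈ Set.Icc (-(D/2)) (D/2), φ (-s) = -φ s) ∧ φ (-(D/2)) = 0 ∧ φ (D/2) = 0})

open Filter Topology

/-- The truncation of a real number to `[-r, r]`. -/
def clip (r x : ℝ) : ℝ := max (-r) (min r x)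

lemma clip_eq_self {r x : ℝ} (h : |x| ≤ r) : clip r x = x := by
  rw [abs_le] at h
  rw [clip, min_eq_right h.2, max_eq_right h.1]

lemma abs_clip_le {r : ℝ} (hr : 0 ≤ r) (x : ℝ) : |clip r x| ≤ r :=
  abs_le.2 ⟨le_max_left _ _, max_le (by linarith) (min_le_left _ _)⟩

lemma abs_clip_le_abs {r : ℝ} (hr : 0 ≤ r) (x : ℝ) : |clip r x| ≤ |x| := by
  rcases le_or_gt |x| r with h | h
  · rw [clip_eq_self h]
  · exact (abs_clip_le hr x).trans h.le

lemma abs_clip_sub_clip_le (r x y : ℝ) : |clip r x - clip r y| ≤ |x - y| := by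
  have h : LipschitzWith 1 (clip r) := (LipschitzWith.id.const_min r).const_max (-r)
  simpa [Real.dist_eq] using h.dist_le_mul x y

/-- A right-derivative Grönwall estimate for planar linear systems. -/
lemma norm_le_of_linear_growth {α α' : ℝ → ℝ × ℝ} {K T : ℝ}
    (hα : ∀ t ∈ Icc 0 T, HasDerivWithinAt α (α' t) (Icc 0 T) t)
    (hb : ∀ t ∈ Icc 0 T, ‖α' t‖ ≤ K * ‖α t‖) :
    ∀ t ∈ Icc 0 T, ‖α t‖ ≤ ‖α 0‖ * exp (K * t) := by
  intro t ht
  have := norm_le_gronwallBound_of_norm_deriv_right_le (f := α) (f' := α') (δ := ‖α 0‖) (K := K)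
    (ε := 0) (a := 0) (b := T) (fun s hs => (hα s hs).continuousWithinAt)
    (fun s hs => ((hα s ⟨hs.1, hs.2.le⟩).mono_of_mem_nhdsWithin (Icc_mem_nhdsGE_of_mem hs)))
    le_rfl (fun s hs => by simpa using hb s ⟨hs.1, hs.2.le⟩) t ht
  simpa [gronwallBound_ε0] using this

/-- Global solvability of the planar system `y' = p z`, `z' = q y`. -/
theorem exists_linear_system_solution {p q : ℝ → ℝ} {T : ℝ} (hT : 0 ≤ T)
    (hp : ContinuousOn p (Icc (-T) T)) (hq : ContinuousOn q (Icc (-T) T)) (a b : ℝ) :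
    ∃ y z : ℝ → ℝ, y 0 = a ∧ z 0 = b ∧ ∀ t ∈ Ioo (-T) T,
      HasDerivAt y (p t * z t) t ∧ HasDerivAt z (q t * y t) t := by
  obtain ⟨K₁, hK₁⟩ := isCompact_Icc.exists_bound_of_continuousOn hp
  obtain ⟨K₂, hK₂⟩ := isCompact_Icc.exists_bound_of_continuousOn hq
  simp only [Real.norm_eq_abs] at hK₁ hK₂
  obtain ⟨K, hK0, hpK, hqK⟩ : ∃ K : ℝ, 0 ≤ K ∧ (∀ t ∈ Icc (-T) T, |p t| ≤ K) ∧
      ∀ t ∈ Icc (-T) T, |q t| ≤ K :=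
    ⟨max 0 (max K₁ K₂), le_max_left _ _, fun t ht => (hK₁ t ht).trans (by simp),
      fun t ht => (hK₂ t ht).trans (by simp)⟩
  set x₀ : ℝ × ℝ := (a, b)
  set r : ℝ := ‖x₀‖ * exp (K * T)
  have hr : 0 ≤ r := by positivity
  let f : ℝ → ℝ × ℝ → ℝ × ℝ := fun t x => (p t * clip r x.2, q t * clip r x.1)
  have hfK : ∀ t ∈ Icc (-T) T, ∀ x, ‖f t x‖ ≤ K * ‖x‖ := by
    intro t ht x
    simp only [f, Prod.norm_def, Real.norm_eq_abs, abs_mul]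
    refine max_le (mul_le_mul (hpK t ht) ?_ (abs_nonneg _) hK0)
      (mul_le_mul (hqK t ht) ?_ (abs_nonneg _) hK0)
    · exact (abs_clip_le_abs hr _).trans (le_max_right _ _)
    · exact (abs_clip_le_abs hr _).trans (le_max_left _ _)
  have hPL : IsPicardLindelof f (tmin := -T) (tmax := T) ⟨0, by constructor <;> linarith⟩ x₀
      ⟨K * r * T, by positivity⟩ 0 ⟨K * r, by positivity⟩ ⟨K, hK0⟩ := by
    refine ⟨fun t ht => ?_, fun x _ => ?_, fun t ht x _ => ?_, ?_⟩
    · refine LipschitzOnWith.of_dist_le_mul fun x _ y _ => ?_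
      simp only [f, Prod.dist_eq, Real.dist_eq, ← mul_sub, abs_mul]
      refine max_le (mul_le_mul (hpK t ht) ?_ (abs_nonneg _) hK0)
        (mul_le_mul (hqK t ht) ?_ (abs_nonneg _) hK0)
      · exact (abs_clip_sub_clip_le _ _ _).trans (le_max_right _ _)
      · exact (abs_clip_sub_clip_le _ _ _).trans (le_max_left _ _)
    · exact (hp.mul continuousOn_const).prodMk (hq.mul continuousOn_const)
    · simp only [f, Prod.norm_def, Real.norm_eq_abs, abs_mul]
      exact max_le (mul_le_mul (hpK t ht) (abs_clip_le hr _) (abs_nonneg _) hK0)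
        (mul_le_mul (hqK t ht) (abs_clip_le hr _) (abs_nonneg _) hK0)
    · simp only [sub_zero, zero_sub, neg_neg, max_self, NNReal.coe_zero]
      exact le_rfl
  obtain ⟨α, hα0, hα⟩ := hPL.exists_eq_forall_mem_Icc_hasDerivWithinAt₀
  simp only at hα0
  have hT' : Icc 0 T ⊆ Icc (-T) T := Icc_subset_Icc_left (by linarith)
  have hpos : ∀ t ∈ Icc 0 T, ‖α t‖ ≤ r := by
    intro t ht
    have := norm_le_of_linear_growth (fun s hs => (hα s (hT' hs)).mono hT')
      (fun s hs => hfK s (hT' hs) _) t ht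
    rw [hα0] at this
    exact this.trans (by simp only [r]; gcongr; exact ht.2)
  have hneg : ∀ t ∈ Icc 0 T, ‖α (-t)‖ ≤ r := by
    intro t ht
    have hm : MapsTo (fun s : ℝ => -s) (Icc 0 T) (Icc (-T) T) :=
      fun s hs => ⟨by linarith [hs.2], by linarith [hs.1]⟩
    have := norm_le_of_linear_growth (α := fun s => α (-s)) (α' := fun s => (-1 : ℝ) • f (-s) (α (-s)))
      (K := K) (fun s hs => (hα (-s) (hm hs)).scomp s (hasDerivAt_neg s).hasDerivWithinAt hm)
      (fun s hs => by simpa using hfK (-s) (hm hs) (α (-s))) t ht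
    simp only [neg_zero, hα0] at this
    exact this.trans (by simp only [r]; gcongr; exact ht.2)
  have hbd : ∀ t ∈ Icc (-T) T, ‖α t‖ ≤ r := by
    intro t ht
    rcases le_total 0 t with h | h
    · exact hpos t ⟨h, ht.2⟩
    · simpa using hneg (-t) ⟨by linarith, by linarith [ht.1]⟩
  refine ⟨fun t => (α t).1, fun t => (α t).2, by simp [hα0, x₀], by simp [hα0, x₀],
    fun t ht => ?_⟩
  have hd := (hα t (Ioo_subset_Icc_self ht)).hasDerivAt (Icc_mem_nhds ht.1 ht.2)
  have hb := hbd t (Ioo_subset_Icc_self ht)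
  have h1 : clip r (α t).1 = (α t).1 := clip_eq_self ((norm_fst_le _).trans hb)
  have h2 : clip r (α t).2 = (α t).2 := clip_eq_self ((norm_snd_le _).trans hb)
  have e : f t (α t) = (p t * (α t).2, q t * (α t).1) := by simp only [f, h1, h2]
  rw [e] at hd
  exact ⟨hd.fst, hd.snd⟩

/-- If `φ` is `C¹` up to the endpoint `c`, vanishes there, and `η` has at most a simple pole
at `c`, then `η φ²` tends to zero at `c`. -/
lemma tendsto_mul_sq_of_simple_pole {φ η : ℝ → ℝ} {S : Set ℝ} {c d ℓ : ℝ} (hc : c ∉ S)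
    (hφ : HasDerivWithinAt φ d S c) (h0 : φ c = 0)
    (hη : Tendsto (fun s => η s * (s - c)) (𝓝[S] c) (𝓝 ℓ)) :
    Tendsto (fun s => η s * φ s ^ 2) (𝓝[S] c) (𝓝 0) := by
  have h1 : Tendsto (fun s => slope φ c s) (𝓝[S] c) (𝓝 d) :=
    (hasDerivWithinAt_iff_tendsto_slope' hc).1 hφ
  have h2 : Tendsto φ (𝓝[S] c) (𝓝 0) := h0 ▸ hφ.continuousWithinAt
  have h3 := (hη.mul h1).mul h2
  rw [mul_zero] at h3
  refine h3.congr' ?_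
  filter_upwards [self_mem_nhdsWithin] with s hs
  have : s - c ≠ 0 := sub_ne_zero.2 fun h => hc (h ▸ hs)
  rw [slope_def_field, h0]
  field_simp
  ring

/-- A function with nonnegative derivative whose left limit is `0` has nonnegative right limit. -/
lemma nonneg_of_tendsto_of_deriv_nonneg {H H' : ℝ → ℝ} {a b ℓ : ℝ} (hab : a < b)
    (hd : ∀ s ∈ Ioo a b, HasDerivAt H (H' s) s) (hH' : ∀ s ∈ Ioo a b, 0 ≤ H' s)
    (ha : Tendsto H (𝓝[>] a) (𝓝 0)) (hb : Tendsto H (𝓝[<] b) (𝓝 ℓ)) : 0 ≤ ℓ := by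
  have hmono : MonotoneOn H (Ioo a b) := by
    refine monotoneOn_of_hasDerivWithinAt_nonneg (f' := H') (convex_Ioo a b)
      (fun s hs => (hd s hs).continuousAt.continuousWithinAt) ?_ ?_
    · rw [interior_Ioo]; exact fun s hs => (hd s hs).hasDerivWithinAt
    · rw [interior_Ioo]; exact hH'
  have hpos : ∀ t ∈ Ioo a b, 0 ≤ H t := by
    intro t ht
    refine le_of_tendsto ha ?_
    filter_upwards [Ioo_mem_nhdsGT ht.1] with s hs
    exact hmono ⟨hs.1, hs.2.trans ht.2⟩ ht hs.2.le
  refine ge_of_tendsto hb ?_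
  filter_upwards [Ioo_mem_nhdsLT hab] with s hs using hpos s hs

/-- Barta–Picone inequality: a Riccati supersolution `η` bounds the Rayleigh quotient with
weight `w`, `w' = -τ w`, from below. -/
theorem picone_inequality {φ g η η' w τ : ℝ → ℝ} {a b Λ ℓa ℓb : ℝ} (hab : a < b)
    (hφ : ∀ s ∈ Icc a b, HasDerivWithinAt φ (g s) (Icc a b) s) (hg : ContinuousOn g (Icc a b))
    (hφa : φ a = 0) (hφb : φ b = 0)
    (hw : ContinuousOn w (Icc a b)) (hw0 : ∀ s ∈ Ioo a b, 0 ≤ w s)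
    (hw' : ∀ s ∈ Ioo a b, HasDerivAt w (-τ s * w s) s)
    (hη : ∀ s ∈ Ioo a b, HasDerivAt η (η' s) s)
    (hric : ∀ s ∈ Ioo a b, η' s + η s ^ 2 - τ s * η s ≤ -Λ)
    (hηa : Tendsto (fun s => η s * (s - a)) (𝓝[>] a) (𝓝 ℓa))
    (hηb : Tendsto (fun s => η s * (s - b)) (𝓝[<] b) (𝓝 ℓb)) :
    Λ * ∫ s in a..b, φ s ^ 2 * w s ≤ ∫ s in a..b, g s ^ 2 * w s := by
  have hφc : ContinuousOn φ (Icc a b) := fun s hs => (hφ s hs).continuousWithinAt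
  let F : ℝ → ℝ := fun s => g s ^ 2 * w s - Λ * (φ s ^ 2 * w s)
  have hF1 : ContinuousOn (fun s => g s ^ 2 * w s) (Icc a b) := (hg.pow 2).mul hw
  have hF2 : ContinuousOn (fun s => φ s ^ 2 * w s) (Icc a b) := (hφc.pow 2).mul hw
  have hF : ContinuousOn F (Icc a b) := hF1.sub (continuousOn_const.mul hF2)
  have hFi : MeasureTheory.IntegrableOn F (Icc a b) := hF.integrableOn_Icc
  let G : ℝ → ℝ := fun t => ∫ s in a..t, F s
  have hGc : ContinuousOn G (Icc a b) := by
    have := intervalIntegral.continuousOn_primitive_interval (f := F) (a := a) (b := b)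
      (μ := MeasureTheory.volume) (by rwa [uIcc_of_le hab.le])
    rwa [uIcc_of_le hab.le] at this
  have hGd : ∀ t ∈ Ioo a b, HasDerivAt G (F t) t := by
    intro t ht
    have hct : ContinuousOn F (Ioo a b) := hF.mono Ioo_subset_Icc_self
    refine intervalIntegral.integral_hasDerivAt_right ?_
      (hct.stronglyMeasurableAtFilter isOpen_Ioo t ht) (hct.continuousAt (Ioo_mem_nhds ht.1 ht.2))
    refine (hF.mono ?_).intervalIntegrable
    rw [uIcc_of_le ht.1.le]
    exact Icc_subset_Icc_right ht.2.le
  have hbdry : Tendsto (fun t => η t * φ t ^ 2 * w t) (𝓝[>] a) (𝓝 0) ∧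
      Tendsto (fun t => η t * φ t ^ 2 * w t) (𝓝[<] b) (𝓝 0) := by
    constructor
    · have h1 := tendsto_mul_sq_of_simple_pole (S := Ioi a) (by simp)
        (((hφ a ⟨le_rfl, hab.le⟩).mono_of_mem_nhdsWithin (Icc_mem_nhdsGT_of_mem ⟨le_rfl, hab⟩)))
        hφa hηa
      have h2 : Tendsto w (𝓝[>] a) (𝓝 (w a)) :=
        (hw a ⟨le_rfl, hab.le⟩).mono_of_mem_nhdsWithin (Icc_mem_nhdsGT_of_mem ⟨le_rfl, hab⟩)
      simpa using h1.mul h2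
    · have h1 := tendsto_mul_sq_of_simple_pole (S := Iio b) (by simp)
        (((hφ b ⟨hab.le, le_rfl⟩).mono_of_mem_nhdsWithin (Icc_mem_nhdsLT_of_mem ⟨hab, le_rfl⟩)))
        hφb hηb
      have h2 : Tendsto w (𝓝[<] b) (𝓝 (w b)) :=
        (hw b ⟨hab.le, le_rfl⟩).mono_of_mem_nhdsWithin (Icc_mem_nhdsLT_of_mem ⟨hab, le_rfl⟩)
      simpa using h1.mul h2
  have hGa : Tendsto G (𝓝[>] a) (𝓝 0) := by
    have : Tendsto G (𝓝[>] a) (𝓝 (G a)) :=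
      (hGc a ⟨le_rfl, hab.le⟩).mono_of_mem_nhdsWithin (Icc_mem_nhdsGT_of_mem ⟨le_rfl, hab⟩)
    simpa [G] using this
  have hGb : Tendsto G (𝓝[<] b) (𝓝 (G b)) :=
    (hGc b ⟨hab.le, le_rfl⟩).mono_of_mem_nhdsWithin (Icc_mem_nhdsLT_of_mem ⟨hab, le_rfl⟩)
  have key : 0 ≤ G b := by
    refine nonneg_of_tendsto_of_deriv_nonneg (H := fun t => G t - η t * φ t ^ 2 * w t)
      (H' := fun t => F t - ((η' t * φ t ^ 2 + η t * (2 * φ t * g t)) * w t +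
        η t * φ t ^ 2 * (-τ t * w t))) hab (fun t ht => ?_) (fun t ht => ?_)
      (by simpa using hGa.sub hbdry.1) (by simpa using hGb.sub hbdry.2)
    · have hφt := (hφ t (Ioo_subset_Icc_self ht)).hasDerivAt (Icc_mem_nhds ht.1 ht.2)
      have h2 := hφt.fun_pow 2
      refine ((hGd t ht).sub (((hη t ht).mul h2).mul (hw' t ht))).congr_deriv ?_
      simp
    · have h1 := hric t ht
      have h2 := hw0 t ht
      have h3 : 0 ≤ w t * ((g t - η t * φ t) ^ 2 +
          φ t ^ 2 * (-Λ - (η' t + η t ^ 2 - τ t * η t))) :=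
        mul_nonneg h2 (add_nonneg (sq_nonneg _) (mul_nonneg (sq_nonneg _) (by linarith)))
      simp only [F]
      linarith
  have e : G b = (∫ s in a..b, g s ^ 2 * w s) - Λ * ∫ s in a..b, φ s ^ 2 * w s := by
    simp only [G, F]
    rw [intervalIntegral.integral_sub, intervalIntegral.integral_const_mul]
    · exact (hF1.mono (by rw [uIcc_of_le hab.le])).intervalIntegrable
    · exact ((continuousOn_const.mul hF2).mono (by rw [uIcc_of_le hab.le])).intervalIntegrable
  linarith

/-- The logarithmic derivative of a function with a nonzero value or a simple zero at `c` has at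
most a simple pole there. -/
lemma tendsto_logDeriv_simple_pole {y y' : ℝ → ℝ} {c : ℝ} (S : Set ℝ) (hc : c ∉ S)
    (hy : HasDerivAt y (y' c) c) (hy' : ContinuousAt y' c) (h : y c ≠ 0 ∨ y' c ≠ 0) :
    ∃ ℓ, Tendsto (fun s => y' s / y s * (s - c)) (𝓝[S] c) (𝓝 ℓ) := by
  have hy'c : Tendsto y' (𝓝[S] c) (𝓝 (y' c)) := hy'.continuousWithinAt
  by_cases h0 : y c = 0
  · have h1 : y' c ≠ 0 := h.resolve_left (by simpa using h0)
    have h2 : Tendsto (slope y c) (𝓝[S] c) (𝓝 (y' c)) :=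
      (hasDerivWithinAt_iff_tendsto_slope' hc).1 hy.hasDerivWithinAt
    refine ⟨y' c / y' c, (hy'c.div h2 h1).congr' ?_⟩
    filter_upwards [self_mem_nhdsWithin] with s hs
    rw [Pi.div_apply, slope_def_field, h0, sub_zero, div_div_eq_mul_div, div_mul_eq_mul_div]
  · have h2 : Tendsto y (𝓝[S] c) (𝓝 (y c)) := hy.continuousAt.continuousWithinAt
    have h3 : Tendsto (fun s => s - c) (𝓝[S] c) (𝓝 (c - c)) :=
      (by fun_prop : ContinuousAt (fun s => s - c) c).continuousWithinAt
    exact ⟨_, (hy'c.div h2 h0).mul h3⟩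

/-- `(y, z)` solves the Sturm–Liouville system `y' = z / w`, `z' = -lam w y` on `(-T, T)`. -/
def SLSolution (w : ℝ → ℝ) (T lam : ℝ) (y z : ℝ → ℝ) : Prop :=
  ∀ t ∈ Ioo (-T) T, HasDerivAt y ((w t)⁻¹ * z t) t ∧ HasDerivAt z (-lam * w t * y t) t

namespace SLSolution

variable {w τ : ℝ → ℝ} {T L lam : ℝ} {y z : ℝ → ℝ}

/-- The data `w` and `L < T` for which the Sturm–Liouville system is regular on `[-T, T]`. -/
structure Weight (w τ : ℝ → ℝ) (T L : ℝ) : Prop where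
  pos_left : 0 < L
  lt_right : L < T
  continuousOn : ContinuousOn w (Icc (-T) T)
  pos : ∀ t ∈ Icc (-T) T, 0 < w t
  deriv : ∀ t ∈ Ioo (-T) T, HasDerivAt w (-τ t * w t) t

lemma Weight.mem_Ioo (h : Weight w τ T L) {t : ℝ} (ht : t ∈ Icc (-L) L) : t ∈ Ioo (-T) T :=
  ⟨by linarith [ht.1, h.lt_right], by linarith [ht.2, h.lt_right]⟩

lemma Weight.mem_Ioo' (h : Weight w τ T L) {t : ℝ} (ht : t ∈ Icc 0 L) : t ∈ Ioo (-T) T :=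
  h.mem_Ioo ⟨by linarith [ht.1, h.pos_left], ht.2⟩

lemma exists_solution (h : Weight w τ T L) (lam a b : ℝ) :
    ∃ y z : ℝ → ℝ, y 0 = a ∧ z 0 = b ∧ SLSolution w T lam y z :=
  exists_linear_system_solution (by linarith [h.pos_left, h.lt_right])
    (h.continuousOn.inv₀ fun t ht => (h.pos t ht).ne') (continuousOn_const.mul h.continuousOn) a b

lemma hasDerivAt_deriv (h : Weight w τ T L) (hs : SLSolution w T lam y z) {t : ℝ}
    (ht : t ∈ Ioo (-T) T) :
    HasDerivAt (fun s => (w s)⁻¹ * z s) (τ t * ((w t)⁻¹ * z t) - lam * y t) t := by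
  have hw := (h.pos t (Ioo_subset_Icc_self ht)).ne'
  refine (((h.deriv t ht).fun_inv hw).mul (hs t ht).2).congr_deriv ?_
  field_simp
  ring

/-- Solutions with the same initial data depend continuously on the spectral parameter. -/
lemma close_of_param_close (h : Weight w τ T L) (hs : SLSolution w T lam y z) {ε : ℝ}
    (hε : 0 < ε) : ∃ δ > 0, ∀ mu, |mu - lam| < δ → ∀ y₁ z₁ : ℝ → ℝ, SLSolution w T mu y₁ z₁ →
      y₁ 0 = y 0 → z₁ 0 = z 0 → ∀ t ∈ Icc 0 L, |y₁ t - y t| < ε ∧ |z₁ t - z t| < ε := by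
  have hsub : Icc 0 L ⊆ Icc (-T) T := fun t ht => Ioo_subset_Icc_self (h.mem_Ioo' ht)
  have hwc := h.continuousOn.mono hsub
  have hyc : ContinuousOn y (Icc 0 L) := fun t ht =>
    (hs t (h.mem_Ioo' ht)).1.continuousAt.continuousWithinAt
  obtain ⟨P, hP⟩ := isCompact_Icc.exists_bound_of_continuousOn
    (hwc.inv₀ fun t ht => (h.pos t (hsub ht)).ne')
  obtain ⟨W, hW⟩ := isCompact_Icc.exists_bound_of_continuousOn hwc
  obtain ⟨M, hM⟩ := isCompact_Icc.exists_bound_of_continuousOn (hwc.mul hyc)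
  simp only [Real.norm_eq_abs] at hP hW hM
  have h0mem : (0 : ℝ) ∈ Icc 0 L := ⟨le_rfl, h.pos_left.le⟩
  have hM0 : 0 ≤ M := (abs_nonneg _).trans (hM 0 h0mem)
  have hW0 : 0 ≤ W := (abs_nonneg _).trans (hW 0 h0mem)
  set K : ℝ := max 1 (max P ((|lam| + 1) * W))
  have hK1 : 1 ≤ K := le_max_left _ _
  have hKP : P ≤ K := (le_max_left _ _).trans (le_max_right _ _)
  have hKW : (|lam| + 1) * W ≤ K := (le_max_right _ _).trans (le_max_right _ _)
  set c : ℝ := M / K * (exp (K * L) - 1)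
  have hexp : 0 ≤ exp (K * L) - 1 := by
    have : 0 ≤ K * L := mul_nonneg (by linarith) h.pos_left.le
    linarith [Real.one_le_exp this]
  have hc : 0 ≤ c := mul_nonneg (div_nonneg hM0 (by linarith)) hexp
  refine ⟨min 1 (ε / (c + 1)), lt_min one_pos (by positivity), ?_⟩
  intro mu hmu y₁ z₁ hs₁ hy0 hz0 t ht
  have hmu1 : |mu - lam| ≤ 1 := (hmu.trans_le (min_le_left _ _)).le
  have hmu2 : |mu - lam| * (c + 1) < ε := by
    rw [← lt_div_iff₀ (by positivity)]; exact hmu.trans_le (min_le_right _ _)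
  have hmuabs : |mu| ≤ |lam| + 1 := by
    have := abs_add_le (mu - lam) lam
    rw [sub_add_cancel] at this
    linarith
  have hder : ∀ s ∈ Icc 0 L, HasDerivAt (fun s => ((y₁ s - y s, z₁ s - z s) : ℝ × ℝ))
      ((w s)⁻¹ * (z₁ s - z s), -mu * w s * (y₁ s - y s) - (mu - lam) * (w s * y s)) s := by
    intro s hs'
    have h1 := hs₁ s (h.mem_Ioo' hs')
    have h2 := hs s (h.mem_Ioo' hs')
    refine ((h1.1.sub h2.1).prodMk (h1.2.sub h2.2)).congr_deriv ?_
    ext <;> simp <;> ring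
  have hgr := norm_le_gronwallBound_of_norm_deriv_right_le (δ := 0) (K := K)
    (ε := |mu - lam| * M) (a := 0) (b := L)
    (fun s hs' => (hder s hs').continuousAt.continuousWithinAt)
    (fun s hs' => (hder s ⟨hs'.1, hs'.2.le⟩).hasDerivWithinAt) (by simp [hy0, hz0]) ?_ t ht
  · have hbound : gronwallBound 0 K (|mu - lam| * M) (t - 0) ≤ |mu - lam| * c := by
      rw [gronwallBound_of_K_ne_0 (by linarith)]
      simp only [c, zero_mul, zero_add, sub_zero]
      have h1 : exp (K * t) ≤ exp (K * L) := by
        apply Real.exp_le_exp.2; exact mul_le_mul_of_nonneg_left ht.2 (by linarith)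
      have h2 : |mu - lam| * M / K * (exp (K * t) - 1) ≤
          |mu - lam| * M / K * (exp (K * L) - 1) :=
        mul_le_mul_of_nonneg_left (by linarith)
          (div_nonneg (mul_nonneg (abs_nonneg _) hM0) (by linarith))
      calc _ ≤ _ := h2
        _ = _ := by ring
    have hlt : |mu - lam| * c < ε := by nlinarith [abs_nonneg (mu - lam)]
    have hfin := (hgr.trans hbound).trans_lt hlt
    exact ⟨(norm_fst_le _).trans_lt hfin, (norm_snd_le _).trans_lt hfin⟩
  · intro s hs'
    have hs'' : s ∈ Icc 0 L := ⟨hs'.1, hs'.2.le⟩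
    simp only [Prod.norm_def, Real.norm_eq_abs]
    set N := max |y₁ s - y s| |z₁ s - z s|
    have hN1 : |y₁ s - y s| ≤ N := le_max_left _ _
    have hN2 : |z₁ s - z s| ≤ N := le_max_right _ _
    have hN0 : 0 ≤ N := (abs_nonneg _).trans hN1
    refine max_le ?_ ?_
    · rw [abs_mul]
      have : |(w s)⁻¹| * |z₁ s - z s| ≤ K * N :=
        mul_le_mul ((hP s hs'').trans hKP) hN2 (abs_nonneg _) (by linarith)
      have : 0 ≤ |mu - lam| * M := by positivity
      linarith
    · refine (abs_sub _ _).trans ?_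
      rw [abs_mul, abs_mul, abs_neg, abs_mul (mu - lam)]
      have h1 : |mu| * |w s| ≤ K :=
        (mul_le_mul hmuabs (hW s hs'') (abs_nonneg _) (by positivity)).trans hKW
      exact add_le_add (mul_le_mul h1 hN1 (abs_nonneg _) (by linarith))
        (mul_le_mul_of_nonneg_left (hM s hs'') (abs_nonneg _))

/-- The spectral parameters of solutions that are positive on `(0, L)` are bounded above. -/
lemma exists_param_bound (h : Weight w τ T L) : ∃ C, ∀ lam y z, SLSolution w T lam y z →
    (∀ t ∈ Ioo 0 L, 0 < y t) → lam ≤ C := by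
  have hL := h.pos_left
  set a := L / 4
  set b := L / 2
  have hab : a < b := by simp only [a, b]; linarith
  have hmem : ∀ t ∈ Icc a b, t ∈ Ioo 0 L := fun t ht =>
    ⟨by have := ht.1; simp only [a] at this; linarith,
      by have := ht.2; simp only [b] at this; linarith⟩
  have hmemT : ∀ t ∈ Icc a b, t ∈ Ioo (-T) T := fun t ht =>
    h.mem_Ioo' (Ioo_subset_Icc_self (hmem t ht))
  let φ : ℝ → ℝ := fun s => (s - a) * (b - s)
  let g : ℝ → ℝ := fun s => 1 * (b - s) + (s - a) * (-1)
  have hφ : ∀ s, HasDerivAt φ (g s) s := fun s =>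
    ((hasDerivAt_id s).sub_const a).mul ((hasDerivAt_id s).const_sub b)
  have hg : Continuous g := by fun_prop
  have hw : ContinuousOn w (Icc a b) :=
    h.continuousOn.mono fun t ht => Ioo_subset_Icc_self (hmemT t ht)
  have hI : 0 < ∫ s in a..b, φ s ^ 2 * w s := by
    refine intervalIntegral.integral_pos hab
      ((Continuous.continuousOn (by fun_prop)).mul hw) (fun s hs => ?_)
      ⟨(a + b) / 2, ⟨by linarith, by linarith⟩, ?_⟩
    · exact mul_nonneg (sq_nonneg _)
        (h.pos s (Ioo_subset_Icc_self (hmemT s (Ioc_subset_Icc_self hs)))).le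
    · refine mul_pos (pow_pos (mul_pos ?_ ?_) 2)
        (h.pos _ (Ioo_subset_Icc_self (hmemT _ ⟨by linarith, by linarith⟩))) <;> linarith
  refine ⟨(∫ s in a..b, g s ^ 2 * w s) / ∫ s in a..b, φ s ^ 2 * w s, fun lam y z hs hy => ?_⟩
  rw [le_div_iff₀ hI]
  have hy' : ∀ s ∈ Icc a b, HasDerivAt (fun s => ((w s)⁻¹ * z s) / y s)
      (((τ s * ((w s)⁻¹ * z s) - lam * y s) * y s - ((w s)⁻¹ * z s) * ((w s)⁻¹ * z s)) / y s ^ 2)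
      s := fun s hs' => (hs.hasDerivAt_deriv h (hmemT s hs')).div (hs s (hmemT s hs')).1
        (hy s (hmem s hs')).ne'
  have hlim : ∀ c ∈ Icc a b, ∀ S : Set ℝ, c ∉ S →
      ∃ ℓ, Tendsto (fun s => (w s)⁻¹ * z s / y s * (s - c)) (𝓝[S] c) (𝓝 ℓ) := fun c hc S hS =>
    tendsto_logDeriv_simple_pole (y := y) (y' := fun s => (w s)⁻¹ * z s) S hS (hs c (hmemT c hc)).1
      (hs.hasDerivAt_deriv h (hmemT c hc)).continuousAt (Or.inl (hy c (hmem c hc)).ne')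
  obtain ⟨ℓa, hℓa⟩ := hlim a ⟨le_rfl, hab.le⟩ (Ioi a) (by simp)
  obtain ⟨ℓb, hℓb⟩ := hlim b ⟨hab.le, le_rfl⟩ (Iio b) (by simp)
  refine picone_inequality (τ := τ) hab (fun s _ => (hφ s).hasDerivWithinAt) hg.continuousOn
    (by simp [φ]) (by simp [φ]) hw
    (fun s hs' => (h.pos s (Ioo_subset_Icc_self (hmemT s (Ioo_subset_Icc_self hs')))).le)
    (fun s hs' => h.deriv s (hmemT s (Ioo_subset_Icc_self hs')))
    (fun s hs' => hy' s (Ioo_subset_Icc_self hs')) (fun s hs' => ?_) hℓa hℓb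
  have := (hy s (hmem s (Ioo_subset_Icc_self hs'))).ne'
  refine le_of_eq ?_
  field_simp
  ring

lemma antitoneOn_of_nonneg (h : Weight w τ T L) (hs : SLSolution w T lam y z) (hlam : 0 ≤ lam)
    (hy : ∀ t ∈ Ioo 0 L, 0 ≤ y t) : AntitoneOn z (Icc 0 L) := by
  refine antitoneOn_of_hasDerivWithinAt_nonpos (f' := fun t => -lam * w t * y t) (convex_Icc 0 L)
    (fun t ht => (hs t (h.mem_Ioo' ht)).2.continuousAt.continuousWithinAt) ?_ ?_ <;>
    rw [interior_Icc]
  · exact fun t ht => (hs t (h.mem_Ioo' (Ioo_subset_Icc_self ht))).2.hasDerivWithinAt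
  · intro t ht
    have := (h.pos t (Ioo_subset_Icc_self (h.mem_Ioo' (Ioo_subset_Icc_self ht)))).le
    have := mul_nonneg (mul_nonneg hlam this) (hy t ht)
    linarith

lemma monotoneOn_of_nonneg (h : Weight w τ T L) (hs : SLSolution w T lam y z) {t : ℝ} (ht : t ≤ L)
    (hz : ∀ s ∈ Icc 0 t, 0 ≤ z s) : MonotoneOn y (Icc 0 t) := by
  have hm : ∀ s ∈ Icc 0 t, s ∈ Ioo (-T) T := fun s hs' => h.mem_Ioo' ⟨hs'.1, hs'.2.trans ht⟩
  refine monotoneOn_of_hasDerivWithinAt_nonneg (f' := fun t => (w t)⁻¹ * z t) (convex_Icc 0 t)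
    (fun s hs' => (hs s (hm s hs')).1.continuousAt.continuousWithinAt) ?_ ?_ <;>
    rw [interior_Icc]
  · exact fun s hs' => (hs s (hm s (Ioo_subset_Icc_self hs'))).1.hasDerivWithinAt
  · intro s hs'
    have hs'' := Ioo_subset_Icc_self hs'
    exact mul_nonneg (inv_nonneg.2 (h.pos s (Ioo_subset_Icc_self (hm s hs''))).le) (hz s hs'')

lemma pos_of_strict_deriv (h : Weight w τ T L) (hs : SLSolution w T lam y z) {t : ℝ} (ht : t ≤ L)
    (hy : y 0 = 0) (hz : ∀ s ∈ Icc 0 t, 0 < z s) : ∀ s ∈ Ioc 0 t, 0 < y s := by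
  have hm : ∀ s ∈ Icc 0 t, s ∈ Ioo (-T) T := fun s hs' => h.mem_Ioo' ⟨hs'.1, hs'.2.trans ht⟩
  have hmono : StrictMonoOn y (Icc 0 t) := by
    refine strictMonoOn_of_hasDerivWithinAt_pos (f' := fun t => (w t)⁻¹ * z t) (convex_Icc 0 t)
      (fun s hs' => (hs s (hm s hs')).1.continuousAt.continuousWithinAt) ?_ ?_ <;>
      rw [interior_Icc]
    · exact fun s hs' => (hs s (hm s (Ioo_subset_Icc_self hs'))).1.hasDerivWithinAt
    · intro s hs'
      have hs'' := Ioo_subset_Icc_self hs'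
      exact mul_pos (inv_pos.2 (h.pos s (Ioo_subset_Icc_self (hm s hs'')))) (hz s hs'')
  intro s hs'
  have := hmono ⟨le_rfl, hs'.1.le.trans hs'.2⟩ ⟨hs'.1.le, hs'.2⟩ hs'.1
  rwa [hy] at this

/-- A nonnegative nontrivial solution is positive in the interior. -/
lemma pos_of_nonneg (h : Weight w τ T L) (hs : SLSolution w T lam y z) (hlam : 0 ≤ lam)
    (hy : ∀ t ∈ Ioo 0 L, 0 ≤ y t) (hy0 : 0 ≤ y 0) (h0 : 0 < y 0 ∨ 0 < z 0) :
    ∀ t ∈ Ioo 0 L, 0 < y t := by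
  intro t ht
  refine (hy t ht).lt_of_ne fun hyt => ?_
  have htT := h.mem_Ioo' (Ioo_subset_Icc_self ht)
  have hmin : IsLocalMin y t := by
    filter_upwards [Ioo_mem_nhds ht.1 ht.2] with s hs'
    rw [← hyt]; exact hy s hs'
  have hzt : z t = 0 := by
    have := hmin.hasDerivAt_eq_zero (hs t htT).1
    simpa [(h.pos t (Ioo_subset_Icc_self htT)).ne'] using this
  have hanti := hs.antitoneOn_of_nonneg h hlam hy
  have hz : ∀ s ∈ Icc 0 t, 0 ≤ z s := fun s hs' => by
    rw [← hzt]
    exact hanti ⟨hs'.1, hs'.2.trans ht.2.le⟩ (Ioo_subset_Icc_self ht) hs'.2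
  have hmono := hs.monotoneOn_of_nonneg h ht.2.le hz
  have hzero : ∀ s ∈ Icc 0 t, y s = 0 := fun s hs' =>
    le_antisymm (by rw [hyt]; exact hmono hs' ⟨ht.1.le, le_rfl⟩ hs'.2)
      (hy0.trans (hmono ⟨le_rfl, ht.1.le⟩ hs' hs'.1))
  have h0mem : (0 : ℝ) ∈ Icc 0 t := ⟨le_rfl, ht.1.le⟩
  have hT0 := h.mem_Ioo' (L := L) (t := 0) ⟨le_rfl, h.pos_left.le⟩
  rcases h0 with h0 | h0
  · exact h0.ne' (hzero 0 h0mem)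
  · have h1 : HasDerivWithinAt y ((w 0)⁻¹ * z 0) (Icc 0 t) 0 := (hs 0 hT0).1.hasDerivWithinAt
    have h2 : HasDerivWithinAt y 0 (Icc 0 t) 0 :=
      (hasDerivWithinAt_const (0 : ℝ) (Icc 0 t) (0 : ℝ)).congr hzero (hzero 0 h0mem)
    have h3 := (uniqueDiffOn_Icc ht.1 0 h0mem).eq_deriv _ h1 h2
    exact (mul_pos (inv_pos.2 (h.pos 0 (Ioo_subset_Icc_self hT0))) h0).ne' h3

/-- Positivity on `(0, L]` persists under small changes of the spectral parameter. -/
lemma pos_of_param_close (h : Weight w τ T L) (hs : SLSolution w T lam y z)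
    (hy : ∀ t ∈ Ioc 0 L, 0 < y t) (h0 : 0 < y 0 ∨ (y 0 = 0 ∧ 0 < z 0)) :
    ∃ δ > 0, ∀ mu, |mu - lam| < δ → ∀ y₁ z₁ : ℝ → ℝ, SLSolution w T mu y₁ z₁ →
      y₁ 0 = y 0 → z₁ 0 = z 0 → ∀ t ∈ Ioo 0 L, 0 < y₁ t := by
  have hyc : ContinuousOn y (Icc 0 L) := fun t ht =>
    (hs t (h.mem_Ioo' ht)).1.continuousAt.continuousWithinAt
  have hL := h.pos_left
  rcases h0 with h0 | ⟨h0, hz0⟩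
  · obtain ⟨t₀, ht₀, hmin⟩ := isCompact_Icc.exists_isMinOn ⟨0, le_rfl, hL.le⟩ hyc
    have hpos : 0 < y t₀ := by
      rcases ht₀.1.eq_or_lt with h1 | h1
      · rwa [← h1]
      · exact hy t₀ ⟨h1, ht₀.2⟩
    obtain ⟨δ, hδ, hc⟩ := hs.close_of_param_close h hpos
    refine ⟨δ, hδ, fun mu hmu y₁ z₁ hs₁ hy0 hz0 t ht => ?_⟩
    have h1 := (abs_lt.1 (hc mu hmu y₁ z₁ hs₁ hy0 hz0 t (Ioo_subset_Icc_self ht)).1).1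
    have h2 := hmin (Ioo_subset_Icc_self ht)
    simp only [mem_ofPred_eq] at h2
    linarith
  · have hzc : ContinuousAt z 0 := (hs 0 (h.mem_Ioo' ⟨le_rfl, hL.le⟩)).2.continuousAt
    obtain ⟨η, hη, hball⟩ := Metric.eventually_nhds_iff.1
      (hzc.eventually (lt_mem_nhds (show z 0 / 2 < z 0 by linarith)))
    set r : ℝ := min (η / 2) L
    have hr : 0 < r := lt_min (by linarith) hL
    have hrL : r ≤ L := min_le_right _ _
    have hzr : ∀ t ∈ Icc 0 r, z 0 / 2 < z t := fun t ht => hball (by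
      rw [Real.dist_eq, sub_zero, abs_of_nonneg ht.1]
      have := ht.2.trans (min_le_left _ _)
      linarith)
    obtain ⟨t₀, ht₀, hmin⟩ := isCompact_Icc.exists_isMinOn (s := Icc r L) ⟨r, le_rfl, hrL⟩
      (hyc.mono (Icc_subset_Icc_left hr.le))
    have hpos : 0 < y t₀ := hy t₀ ⟨hr.trans_le ht₀.1, ht₀.2⟩
    obtain ⟨δ, hδ, hc⟩ := hs.close_of_param_close h (lt_min hpos (half_pos hz0))
    refine ⟨δ, hδ, fun mu hmu y₁ z₁ hs₁ hy0 hz0 t ht => ?_⟩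
    have hc' := hc mu hmu y₁ z₁ hs₁ hy0 hz0
    rcases le_total t r with htr | htr
    · refine hs₁.pos_of_strict_deriv h hrL (hy0.trans h0) (fun s hs' => ?_) t ⟨ht.1, htr⟩
      have h1 := (abs_lt.1 (hc' s ⟨hs'.1, hs'.2.trans hrL⟩).2).1
      have h2 := hzr s hs'
      have h3 := min_le_right (y t₀) (z 0 / 2)
      linarith
    · have h1 := (abs_lt.1 (hc' t (Ioo_subset_Icc_self ht)).1).1
      have h2 := hmin (show t ∈ Icc r L from ⟨htr, ht.2.le⟩)
      have h3 := min_le_left (y t₀) (z 0 / 2)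
      simp only [mem_ofPred_eq] at h2
      linarith

/-- Shooting: some spectral parameter makes the solution with prescribed data at `0` positive on
`(0, L)` and zero at `L`. -/
theorem exists_first_zero (h : Weight w τ T L) {a b : ℝ} (hb : 0 ≤ b)
    (hab : 0 < a ∨ (a = 0 ∧ 0 < b)) :
    ∃ lam y z, 0 ≤ lam ∧ SLSolution w T lam y z ∧ y 0 = a ∧ z 0 = b ∧
      (∀ t ∈ Ioo 0 L, 0 < y t) ∧ y L = 0 := by
  have ha : 0 ≤ a := by rcases hab with h | ⟨h, _⟩ <;> linarith
  have hab' : 0 < a ∨ 0 < b := hab.imp id And.right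
  have hL := h.pos_left
  let A : Set ℝ := {lam | 0 ≤ lam ∧ ∃ y z, SLSolution w T lam y z ∧ y 0 = a ∧ z 0 = b ∧
    ∀ t ∈ Ioo 0 L, 0 < y t}
  have hA0 : (0 : ℝ) ∈ A := by
    obtain ⟨y, z, hy0, hz0, hs⟩ := exists_solution h 0 a b
    refine ⟨le_rfl, y, z, hs, hy0, hz0, ?_⟩
    have hz : ∀ t ∈ Icc 0 L, z t = z 0 :=
      constant_of_derivWithin_zero
        (fun t ht => (hs t (h.mem_Ioo' ht)).2.differentiableAt.differentiableWithinAt)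
        (fun t ht => by
          have h1 := (hs t (h.mem_Ioo' ⟨ht.1, ht.2.le⟩)).2.hasDerivWithinAt (s := Icc 0 L)
          rw [h1.derivWithin (uniqueDiffOn_Icc hL t ⟨ht.1, ht.2.le⟩)]
          simp)
    have hmono := hs.monotoneOn_of_nonneg h le_rfl fun t ht => by rw [hz t ht, hz0]; exact hb
    refine hs.pos_of_nonneg h le_rfl (fun t ht => ?_) (hy0 ▸ ha) (by rwa [hy0, hz0])
    have := hmono ⟨le_rfl, hL.le⟩ (Ioo_subset_Icc_self ht) ht.1.le
    linarith
  have hAb : BddAbove A := by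
    obtain ⟨C, hC⟩ := exists_param_bound h
    exact ⟨C, fun lam ⟨_, y, z, hs, _, _, hy⟩ => hC lam y z hs hy⟩
  have hsup : 0 ≤ sSup A := le_csSup hAb hA0
  obtain ⟨y, z, hy0, hz0, hs⟩ := exists_solution h (sSup A) a b
  have hnn : ∀ t ∈ Ioo 0 L, 0 ≤ y t := by
    intro t ht
    by_contra! hneg
    obtain ⟨δ, hδ, hc⟩ := hs.close_of_param_close h (neg_pos.2 hneg)
    obtain ⟨mu, ⟨_, y₁, z₁, hs₁, hy₁, hz₁, hpos⟩, hmu⟩ :=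
      exists_lt_of_lt_csSup ⟨0, hA0⟩ (show sSup A - δ < sSup A by linarith)
    have hle : mu ≤ sSup A := le_csSup hAb ⟨‹_›, y₁, z₁, hs₁, hy₁, hz₁, hpos⟩
    have h1 := (abs_lt.1 (hc mu (abs_lt.2 ⟨by linarith, by linarith⟩) y₁ z₁ hs₁
      (hy₁.trans hy0.symm) (hz₁.trans hz0.symm) t (Ioo_subset_Icc_self ht)).1).2
    linarith [hpos t ht]
  have hpos := hs.pos_of_nonneg h hsup hnn (hy0 ▸ ha) (by rwa [hy0, hz0])
  refine ⟨sSup A, y, z, hsup, hs, hy0, hz0, hpos, ?_⟩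
  have hyL : 0 ≤ y L := by
    have hc : Tendsto y (𝓝[<] L) (𝓝 (y L)) :=
      (hs L (h.mem_Ioo' ⟨hL.le, le_rfl⟩)).1.continuousAt.continuousWithinAt
    refine ge_of_tendsto hc ?_
    filter_upwards [Ioo_mem_nhdsLT hL] with t ht using hnn t ht
  by_contra hne
  have hyL' : 0 < y L := hyL.lt_of_ne' hne
  obtain ⟨δ, hδ, hc⟩ := hs.pos_of_param_close h (fun t ht => by
    rcases ht.2.eq_or_lt with h1 | h1
    · rwa [h1]
    · exact hpos t ⟨ht.1, h1⟩) (by rwa [hy0, hz0])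
  obtain ⟨y₁, z₁, hy₁, hz₁, hs₁⟩ := exists_solution h (sSup A + δ / 2) a b
  have hmem : sSup A + δ / 2 ∈ A := ⟨by linarith, y₁, z₁, hs₁, hy₁, hz₁,
    hc _ (by rw [add_sub_cancel_left, abs_of_pos (by linarith)]; linarith) y₁ z₁ hs₁
      (hy₁.trans hy0.symm) (hz₁.trans hz0.symm)⟩
  linarith [le_csSup hAb hmem]

/-- The derivative does not vanish at the first zero. -/
lemma neg_of_first_zero (h : Weight w τ T L) (hs : SLSolution w T lam y z) (hlam : 0 ≤ lam)
    (hpos : ∀ t ∈ Ioo 0 L, 0 < y t) (hL : y L = 0) : z L < 0 := by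
  by_contra! hz
  have hL0 := h.pos_left
  have hanti := hs.antitoneOn_of_nonneg h hlam fun t ht => (hpos t ht).le
  have hmono := hs.monotoneOn_of_nonneg h le_rfl fun t ht =>
    hz.trans (hanti ht ⟨hL0.le, le_rfl⟩ ht.2)
  have h1 := hpos (L / 2) ⟨by linarith, by linarith⟩
  have h2 := hmono (a := L / 2) (b := L) ⟨by linarith, by linarith⟩ ⟨hL0.le, le_rfl⟩ (by linarith)
  linarith

/-- The eigenfunctions of an even weight with even or odd initial data are even or odd. -/
lemma reflect (h : Weight w τ T L) (hw : ∀ t, w (-t) = w t) (hs : SLSolution w T lam y z)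
    {σ : ℝ} (hσ : σ * σ = 1) (hy : σ * y 0 = y 0) (hz : -σ * z 0 = z 0) :
    ∀ t ∈ Icc (-L) L, y (-t) = σ * y t ∧ z (-t) = -σ * z t := by
  have hs' : SLSolution w T lam (fun t => σ * y (-t)) (fun t => -σ * z (-t)) := by
    intro t ht
    obtain ⟨h1, h2⟩ := hs (-t) ⟨by linarith [ht.2], by linarith [ht.1]⟩
    rw [hw] at h1 h2
    constructor
    · exact ((h1.comp t (hasDerivAt_neg t)).const_mul σ).congr_deriv (by ring)
    · exact ((h2.comp t (hasDerivAt_neg t)).const_mul (-σ)).congr_deriv (by ring)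
  have hpos : ∀ t ∈ Icc 0 L, σ * y (-t) = y t ∧ -σ * z (-t) = z t := by
    intro t ht
    have hclose : ∀ ε > 0, |σ * y (-t) - y t| < ε ∧ |-σ * z (-t) - z t| < ε := by
      intro ε hε
      obtain ⟨δ, hδ, hc⟩ := hs.close_of_param_close h hε
      exact hc lam (by simpa using hδ) _ _ hs' (by simpa using hy) (by simpa using hz) t ht
    constructor
    · exact eq_of_abs_sub_nonpos (le_of_forall_gt fun ε hε => (hclose ε hε).1)
    · exact eq_of_abs_sub_nonpos (le_of_forall_gt fun ε hε => (hclose ε hε).2)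
  intro t ht
  rcases le_total 0 t with h0 | h0
  · obtain ⟨h1, h2⟩ := hpos t ⟨h0, ht.2⟩
    constructor
    · rw [← h1, ← mul_assoc, hσ, one_mul]
    · rw [← h2, ← mul_assoc, neg_mul_neg, hσ, one_mul]
  · obtain ⟨h1, h2⟩ := hpos (-t) ⟨by linarith, by linarith [ht.1]⟩
    rw [neg_neg] at h1 h2
    exact ⟨h1.symm, h2.symm⟩

end SLSolution

/-- The weight `cos ^ m` has logarithmic derivative `-m tan`. -/
lemma hasDerivAt_cos_pow (m : ℕ) {t : ℝ} (ht : t ∈ Ioo (-(π / 2)) (π / 2)) :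
    HasDerivAt (fun s => cos s ^ m) (-(m * tan t) * cos t ^ m) t := by
  have hc := (cos_pos_of_mem_Ioo ht).ne'
  refine ((hasDerivAt_cos t).pow m).congr_deriv ?_
  rw [tan_eq_sin_div_cos]
  rcases m with _ | k
  · simp
  · rw [Nat.add_sub_cancel, pow_succ]
    field_simp

lemma weight_cos (m : ℕ) {T L : ℝ} (hL : 0 < L) (hLT : L < T) (hT : T < π / 2) :
    SLSolution.Weight (fun s => cos s ^ m) (fun s => m * tan s) T L where
  pos_left := hL
  lt_right := hLT
  continuousOn := by fun_prop
  pos := fun t ht => pow_pos (cos_pos_of_mem_Ioo ⟨by linarith [ht.1], by linarith [ht.2]⟩) m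
  deriv := fun t ht => hasDerivAt_cos_pow m ⟨by linarith [ht.1], by linarith [ht.2]⟩

/-- The equation `y'' - τ y' + lam y = 0` on `S`, in first order form. -/
def DriftODE (τ : ℝ → ℝ) (lam : ℝ) (S : Set ℝ) (y y' : ℝ → ℝ) : Prop :=
  ∀ t ∈ S, HasDerivAt y (y' t) t ∧ HasDerivAt y' (τ t * y' t - lam * y t) t

/-- The eigenvalue equation `y'' - m tan y' + lam y = 0` on `S`. -/
abbrev ModelODE (m : ℕ) (lam : ℝ) (S : Set ℝ) (y dy : ℝ → ℝ) : Prop :=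
  DriftODE (fun t => m * tan t) lam S y dy

/-- A Dirichlet eigenfunction on `[-L, L]`, positive on `(0, L)`, whose parity is `σ = ± 1`. -/
structure ModelEigen (m : ℕ) (L σ lam : ℝ) (y y' : ℝ → ℝ) : Prop where
  ode : ModelODE m lam (Icc (-L) L) y y'
  symm : ∀ t ∈ Icc (-L) L, y (-t) = σ * y t
  symm_deriv : ∀ t ∈ Icc (-L) L, y' (-t) = -σ * y' t
  pos : ∀ t ∈ Ioo 0 L, 0 < y t
  right : y L = 0
  right_deriv : y' L < 0

lemma exists_even_eigen (m : ℕ) {L : ℝ} (hL : 0 < L) (hL' : L < π / 2) :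
    ∃ lam y y', ModelEigen m L 1 lam y y' ∧ 0 < lam ∧ y 0 = 1 ∧ y' 0 = 0 ∧
      ∀ t ∈ Icc 0 L, y' t ≤ 0 := by
  have h := weight_cos m hL (show L < (L + π / 2) / 2 by linarith) (by linarith)
  have h0 : (0 : ℝ) ∈ Icc 0 L := ⟨le_rfl, hL.le⟩
  have hLm : L ∈ Icc 0 L := ⟨hL.le, le_rfl⟩
  have hw : ∀ t ∈ Icc (-L) L, 0 < cos t ^ m := fun t ht =>
    h.pos t (Ioo_subset_Icc_self (h.mem_Ioo ht))
  have hsub : ∀ {t}, t ∈ Icc 0 L → t ∈ Icc (-L) L := fun ht => ⟨by linarith [ht.1], ht.2⟩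
  obtain ⟨lam, y, z, hlam, hs, hy0, hz0, hpos, hyL⟩ :=
    SLSolution.exists_first_zero h le_rfl (Or.inl (one_pos))
  have hzL := hs.neg_of_first_zero h hlam hpos hyL
  have hsymm := hs.reflect h (by simp) (σ := 1) (by simp) (by simp) (by simp [hz0])
  have hanti := hs.antitoneOn_of_nonneg h hlam fun t ht => (hpos t ht).le
  refine ⟨lam, y, fun t => (cos t ^ m)⁻¹ * z t, ⟨fun t ht => ⟨(hs t (h.mem_Ioo ht)).1,
    hs.hasDerivAt_deriv h (h.mem_Ioo ht)⟩, fun t ht => (hsymm t ht).1, fun t ht => ?_, hpos, hyL,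
    mul_neg_of_pos_of_neg (inv_pos.2 (hw L (hsub hLm))) hzL⟩, ?_, hy0, by simp [hz0],
    fun t ht => mul_nonpos_of_nonneg_of_nonpos (inv_pos.2 (hw t (hsub ht))).le
      (hz0 ▸ hanti h0 ht ht.1)⟩
  · simp only [cos_neg, (hsymm t ht).2]
    ring
  · refine hlam.lt_of_ne' fun hl => ?_
    have hz : z L = z 0 := by
      refine constant_of_derivWithin_zero (a := 0) (b := L)
        (fun t ht => (hs t (h.mem_Ioo' ht)).2.differentiableAt.differentiableWithinAt)
        (fun t ht => ?_) L hLm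
      have h1 := (hs t (h.mem_Ioo' ⟨ht.1, ht.2.le⟩)).2.hasDerivWithinAt (s := Icc 0 L)
      rw [h1.derivWithin (uniqueDiffOn_Icc hL t ⟨ht.1, ht.2.le⟩), hl]
      simp
    linarith

lemma exists_odd_eigen (m : ℕ) {L : ℝ} (hL : 0 < L) (hL' : L < π / 2) :
    ∃ lam y y', ModelEigen m L (-1) lam y y' ∧ y 0 = 0 ∧ y' 0 = 1 := by
  have h := weight_cos m hL (show L < (L + π / 2) / 2 by linarith) (by linarith)
  obtain ⟨lam, y, z, hlam, hs, hy0, hz0, hpos, hyL⟩ :=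
    SLSolution.exists_first_zero h zero_le_one (Or.inr ⟨rfl, one_pos⟩)
  have hsymm := hs.reflect h (by simp) (σ := -1) (by simp) (by simp [hy0]) (by simp)
  refine ⟨lam, y, fun t => (cos t ^ m)⁻¹ * z t, ⟨fun t ht => ⟨(hs t (h.mem_Ioo ht)).1,
    hs.hasDerivAt_deriv h (h.mem_Ioo ht)⟩, fun t ht => (hsymm t ht).1, fun t ht => ?_, hpos, hyL,
    mul_neg_of_pos_of_neg (inv_pos.2 (h.pos L (Ioo_subset_Icc_self
      (h.mem_Ioo' ⟨hL.le, le_rfl⟩)))) (hs.neg_of_first_zero h hlam hpos hyL)⟩, hy0, by simp [hz0]⟩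
  simp only [cos_neg, (hsymm t ht).2]
  ring

/-- The energy identity for Dirichlet solutions of the eigenvalue equation. -/
lemma DriftODE.integral_deriv_sq {m : ℕ} {lam a b : ℝ} {y y' : ℝ → ℝ} (hab : a < b)
    (ha : -(π / 2) < a) (hb : b < π / 2) (h : ModelODE m lam (Icc a b) y y')
    (hya : y a = 0) (hyb : y b = 0) :
    ∫ s in a..b, y' s ^ 2 * cos s ^ m = lam * ∫ s in a..b, y s ^ 2 * cos s ^ m := by
  have hy : ContinuousOn y (Icc a b) := fun t ht => (h t ht).1.continuousAt.continuousWithinAt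
  have hy' : ContinuousOn y' (Icc a b) := fun t ht => (h t ht).2.continuousAt.continuousWithinAt
  have hi1 : IntervalIntegrable (fun s => y' s ^ 2 * cos s ^ m) MeasureTheory.volume a b :=
    ContinuousOn.intervalIntegrable_of_Icc hab.le (by fun_prop)
  have hi2 : IntervalIntegrable (fun s => y s ^ 2 * cos s ^ m) MeasureTheory.volume a b :=
    ContinuousOn.intervalIntegrable_of_Icc hab.le (by fun_prop)
  have key := intervalIntegral.integral_eq_sub_of_hasDerivAt
    (f := fun s => y s * (cos s ^ m * y' s))
    (f' := fun s => y' s ^ 2 * cos s ^ m - lam * (y s ^ 2 * cos s ^ m)) (a := a) (b := b)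
    (fun t ht => by
      rw [uIcc_of_le hab.le] at ht
      have hw := hasDerivAt_cos_pow m (t := t) ⟨by linarith [ht.1], by linarith [ht.2]⟩
      refine ((h t ht).1.mul (hw.mul (h t ht).2)).congr_deriv ?_
      simp only [Pi.mul_apply]
      ring) (hi1.sub (hi2.const_mul lam))
  rw [intervalIntegral.integral_sub hi1 (hi2.const_mul lam), hya, hyb,
    intervalIntegral.integral_const_mul] at key
  linarith

lemma integral_sq_mul_cos_pow_pos {m : ℕ} {a b : ℝ} {y : ℝ → ℝ} (hab : a < b)
    (ha : -(π / 2) < a) (hb : b < π / 2) (hy : ContinuousOn y (Icc a b))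
    (h0 : ∃ s ∈ Icc a b, y s ≠ 0) : 0 < ∫ s in a..b, y s ^ 2 * cos s ^ m := by
  have hw : ∀ s ∈ Icc a b, 0 < cos s ^ m := fun s hs =>
    pow_pos (cos_pos_of_mem_Ioo ⟨by linarith [hs.1], by linarith [hs.2]⟩) m
  obtain ⟨s, hs, hne⟩ := h0
  exact intervalIntegral.integral_pos hab (by fun_prop)
    (fun t ht => mul_nonneg (sq_nonneg _) (hw t (Ioc_subset_Icc_self ht)).le)
    ⟨s, hs, mul_pos (by positivity) (hw s hs)⟩

/-- A Riccati supersolution with simple poles at the endpoints bounds Dirichlet eigenvalues from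
below. -/
lemma DriftODE.le_of_riccati {m : ℕ} {lam a b Λ ℓa ℓb : ℝ} {y y' η η' : ℝ → ℝ} (hab : a < b)
    (ha : -(π / 2) < a) (hb : b < π / 2) (h : ModelODE m lam (Icc a b) y y')
    (hya : y a = 0) (hyb : y b = 0) (h0 : ∃ s ∈ Icc a b, y s ≠ 0)
    (hη : ∀ s ∈ Ioo a b, HasDerivAt η (η' s) s)
    (hric : ∀ s ∈ Ioo a b, η' s + η s ^ 2 - m * tan s * η s ≤ -Λ)
    (hηa : Tendsto (fun s => η s * (s - a)) (𝓝[>] a) (𝓝 ℓa))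
    (hηb : Tendsto (fun s => η s * (s - b)) (𝓝[<] b) (𝓝 ℓb)) : Λ ≤ lam := by
  have hpos := integral_sq_mul_cos_pow_pos (m := m) hab ha hb
    (fun t ht => (h t ht).1.continuousAt.continuousWithinAt) h0
  have hpic := picone_inequality (w := fun s => cos s ^ m) (τ := fun s => m * tan s) hab
    (fun s hs => (h s hs).1.hasDerivWithinAt)
    (fun t ht => (h t ht).2.continuousAt.continuousWithinAt) hya hyb (by fun_prop)
    (fun s hs => pow_nonneg (cos_pos_of_mem_Ioo ⟨by linarith [hs.1], by linarith [hs.2]⟩).le m)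
    (fun s hs => hasDerivAt_cos_pow m ⟨by linarith [hs.1], by linarith [hs.2]⟩) hη hric hηa hηb
  rw [h.integral_deriv_sq hab ha hb hya hyb] at hpic
  exact le_of_mul_le_mul_right hpic hpos

/-- The logarithmic derivative of a solution satisfies the Riccati equation. -/
lemma DriftODE.hasDerivAt_logDeriv {τ : ℝ → ℝ} {lam : ℝ} {S : Set ℝ} {y y' : ℝ → ℝ}
    (h : DriftODE τ lam S y y') {t : ℝ} (ht : t ∈ S) (h0 : y t ≠ 0) :
    HasDerivAt (fun s => y' s / y s) (τ t * (y' t / y t) - lam - (y' t / y t) ^ 2) t := by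
  refine ((h t ht).2.div (h t ht).1 h0).congr_deriv ?_
  field_simp

lemma DriftODE.tendsto_logDeriv {τ : ℝ → ℝ} {lam : ℝ} {S : Set ℝ} {y y' : ℝ → ℝ}
    (h : DriftODE τ lam S y y') {c : ℝ} (hc : c ∈ S) (h0 : y c ≠ 0 ∨ y' c ≠ 0) (A : Set ℝ)
    (hA : c ∉ A) : ∃ ℓ, Tendsto (fun s => y' s / y s * (s - c)) (𝓝[A] c) (𝓝 ℓ) :=
  tendsto_logDeriv_simple_pole A hA (h c hc).1 (h c hc).2.continuousAt h0

lemma DriftODE.mono {τ : ℝ → ℝ} {lam : ℝ} {S S' : Set ℝ} {y y' : ℝ → ℝ}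
    (h : DriftODE τ lam S y y') (hS : S' ⊆ S) : DriftODE τ lam S' y y' := fun t ht => h t (hS ht)

lemma DriftODE.comp_mul {τ : ℝ → ℝ} {lam : ℝ} {S : Set ℝ} {y y' : ℝ → ℝ}
    (h : DriftODE τ lam S y y') (κ : ℝ) :
    DriftODE (fun t => κ * τ (κ * t)) (κ ^ 2 * lam) {t | κ * t ∈ S} (fun t => y (κ * t))
      (fun t => κ * y' (κ * t)) := by
  intro t ht
  have hm : HasDerivAt (fun s : ℝ => κ * s) κ t := by simpa using (hasDerivAt_id t).const_mul κ
  obtain ⟨h1, h2⟩ := h (κ * t) ht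
  exact ⟨(h1.comp t hm).congr_deriv (by ring),
    ((h2.comp t hm).const_mul κ).congr_deriv (by ring)⟩

/-- A solution without zeros in `(a, b)` bounds the Dirichlet energy on `[a, b]` from below. -/
lemma DriftODE.energy_bound {m : ℕ} {lam a b : ℝ} {y y' φ g : ℝ → ℝ} (hab : a < b)
    (ha : -(π / 2) < a) (hb : b < π / 2) (h : ModelODE m lam (Icc a b) y y')
    (hne : ∀ t ∈ Ioo a b, y t ≠ 0) (hya : y a ≠ 0 ∨ y' a ≠ 0) (hyb : y b ≠ 0 ∨ y' b ≠ 0)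
    (hφ : ∀ s ∈ Icc a b, HasDerivWithinAt φ (g s) (Icc a b) s) (hg : ContinuousOn g (Icc a b))
    (hφa : φ a = 0) (hφb : φ b = 0) :
    lam * ∫ s in a..b, φ s ^ 2 * cos s ^ m ≤ ∫ s in a..b, g s ^ 2 * cos s ^ m := by
  obtain ⟨ℓa, hℓa⟩ := h.tendsto_logDeriv ⟨le_rfl, hab.le⟩ hya (Ioi a) (by simp)
  obtain ⟨ℓb, hℓb⟩ := h.tendsto_logDeriv ⟨hab.le, le_rfl⟩ hyb (Iio b) (by simp)
  exact picone_inequality (w := fun s => cos s ^ m) (τ := fun s => m * tan s) hab hφ hg hφa hφb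
    (by fun_prop)
    (fun s hs => pow_nonneg (cos_pos_of_mem_Ioo ⟨by linarith [hs.1], by linarith [hs.2]⟩).le m)
    (fun s hs => hasDerivAt_cos_pow m ⟨by linarith [hs.1], by linarith [hs.2]⟩)
    (fun s hs => h.hasDerivAt_logDeriv (Ioo_subset_Icc_self hs) (hne s hs))
    (fun s hs => by linarith) hℓa hℓb

namespace ModelEigen

variable {m n : ℕ} {D L σ lam : ℝ} {y y' : ℝ → ℝ}

lemma left (h : ModelEigen m L σ lam y y') (hL : 0 < L) : y (-L) = 0 := by
  rw [h.symm L ⟨by linarith, le_rfl⟩, h.right, mul_zero]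

lemma left_deriv (h : ModelEigen m L σ lam y y') (hL : 0 < L) (hσ : σ ≠ 0) : y' (-L) ≠ 0 := by
  rw [h.symm_deriv L ⟨by linarith, le_rfl⟩]
  exact mul_ne_zero (neg_ne_zero.2 hσ) h.right_deriv.ne

lemma ne_zero (h : ModelEigen m L σ lam y y') (hσ : σ ≠ 0) {t : ℝ} (ht : t ∈ Ioo (-L) L)
    (h0 : t ≠ 0) : y t ≠ 0 := by
  rcases h0.lt_or_gt with ht0 | ht0
  · have h1 := h.symm (-t) ⟨by linarith [ht.2], by linarith [ht.1]⟩
    rw [neg_neg] at h1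
    rw [h1]
    exact mul_ne_zero hσ (h.pos _ ⟨by linarith, by linarith [ht.1]⟩).ne'
  · exact (h.pos t ⟨ht0, ht.2⟩).ne'

lemma exists_ne_zero (h : ModelEigen m L σ lam y y') (hL : 0 < L) :
    ∃ s ∈ Icc (-L) L, y s ≠ 0 :=
  ⟨L / 2, ⟨by linarith, by linarith⟩, (h.pos _ ⟨by linarith, by linarith⟩).ne'⟩

lemma contDiffOn (h : ModelEigen m L σ lam y y') (hL : 0 < L) :
    ContDiffOn ℝ 1 y (Icc (-L) L) := by
  have hu := uniqueDiffOn_Icc (show -L < L by linarith)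
  refine (contDiffOn_one_iff_derivWithin hu).2
    ⟨fun t ht => (h.ode t ht).1.differentiableAt.differentiableWithinAt, ?_⟩
  refine ContinuousOn.congr (f := y')
    (fun t ht => (h.ode t ht).2.continuousAt.continuousWithinAt) fun t ht => ?_
  exact (h.ode t ht).1.hasDerivWithinAt.derivWithin (hu t ht)

lemma rayleighQ_eq (h : ModelEigen (n - 1) (D / 2) σ lam y y') (hD : 0 < D) (hD' : D < π) :
    rayleighQ n D y = lam := by
  have hL : -(D / 2) < D / 2 := by linarith
  have hpos := integral_sq_mul_cos_pow_pos (m := n - 1) hL (by linarith) (by linarith)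
    (h.contDiffOn (by linarith)).continuousOn (h.exists_ne_zero (by linarith))
  rw [rayleighQ, div_eq_iff hpos.ne', ← h.ode.integral_deriv_sq hL (by linarith) (by linarith)
    (h.left (by linarith)) h.right]
  refine intervalIntegral.integral_congr fun t ht => ?_
  rw [uIcc_of_le hL.le] at ht
  simp only [(h.ode t ht).1.deriv]

end ModelEigen

lemma le_rayleighQ {n : ℕ} {D Λ : ℝ} {φ : ℝ → ℝ} (hD : 0 < D) (hD' : D < π)
    (hφ : ContDiffOn ℝ 1 φ (Icc (-(D / 2)) (D / 2))) (h0 : ∃ s ∈ Icc (-(D / 2)) (D / 2), φ s ≠ 0)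
    (h : ∀ g : ℝ → ℝ, (∀ s ∈ Icc (-(D / 2)) (D / 2),
      HasDerivWithinAt φ (g s) (Icc (-(D / 2)) (D / 2)) s) →
      ContinuousOn g (Icc (-(D / 2)) (D / 2)) →
      Λ * ∫ s in -(D / 2)..D / 2, φ s ^ 2 * cos s ^ (n - 1) ≤
        ∫ s in -(D / 2)..D / 2, g s ^ 2 * cos s ^ (n - 1)) : Λ ≤ rayleighQ n D φ := by
  have hL : -(D / 2) < D / 2 := by linarith
  have hu := uniqueDiffOn_Icc hL
  have hpos := integral_sq_mul_cos_pow_pos (m := n - 1) hL (by linarith) (by linarith)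
    hφ.continuousOn h0
  rw [rayleighQ, le_div_iff₀ hpos]
  obtain ⟨hd, hc⟩ := (contDiffOn_one_iff_derivWithin hu).1 hφ
  refine (h _ (fun s hs => (hd s hs).hasDerivWithinAt) hc).trans_eq ?_
  refine intervalIntegral.integral_congr_Ioo_of_le hL.le fun t ht => ?_
  simp only [derivWithin_of_mem_nhds (Icc_mem_nhds ht.1 ht.2)]

lemma ModelEigen.modelLam1_eq {n : ℕ} {D lam : ℝ} {y y' : ℝ → ℝ} (hD : 0 < D) (hD' : D < π)
    (h : ModelEigen (n - 1) (D / 2) 1 lam y y') (h0 : y 0 ≠ 0) : modelLam1 n D = lam := by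
  have hL : 0 < D / 2 := by linarith
  refine IsLeast.csInf_eq ⟨⟨y, ⟨h.contDiffOn hL, h.exists_ne_zero hL, h.left hL, h.right⟩,
    h.rayleighQ_eq hD hD'⟩, ?_⟩
  rintro _ ⟨φ, ⟨hφ, hφ0, hφl, hφr⟩, rfl⟩
  refine le_rayleighQ hD hD' hφ hφ0 fun g hg hgc =>
    h.ode.energy_bound (by linarith) (by linarith) (by linarith) (fun t ht => ?_)
      (Or.inr (h.left_deriv hL one_ne_zero)) (Or.inr h.right_deriv.ne) hg hgc hφl hφr
  by_cases ht0 : t = 0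
  · rwa [ht0]
  · exact h.ne_zero one_ne_zero ht ht0

lemma ModelEigen.modelLam2_eq {n : ℕ} {D lam : ℝ} {y y' : ℝ → ℝ} (hD : 0 < D) (hD' : D < π)
    (h : ModelEigen (n - 1) (D / 2) (-1) lam y y') (h0 : y' 0 ≠ 0) : modelLam2 n D = lam := by
  have hL : 0 < D / 2 := by linarith
  have hσ : (-1 : ℝ) ≠ 0 := by norm_num
  refine IsLeast.csInf_eq ⟨⟨y, ⟨h.contDiffOn hL, h.exists_ne_zero hL, fun s hs => ?_, h.left hL,
    h.right⟩, h.rayleighQ_eq hD hD'⟩, ?_⟩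
  · rw [h.symm s hs, neg_one_mul]
  rintro _ ⟨φ, ⟨hφ, hφ0, hodd, hφl, hφr⟩, rfl⟩
  have hz : φ 0 = 0 := by
    have := hodd 0 ⟨by linarith, hL.le⟩
    rw [neg_zero] at this
    linarith
  refine le_rayleighQ hD hD' hφ hφ0 fun g hg hgc => ?_
  have hsub1 : Icc (-(D / 2)) 0 ⊆ Icc (-(D / 2)) (D / 2) := Icc_subset_Icc_right hL.le
  have hsub2 : Icc 0 (D / 2) ⊆ Icc (-(D / 2)) (D / 2) := Icc_subset_Icc_left (by linarith)
  have e1 := (h.ode.mono hsub1).energy_bound (φ := φ) (g := g) (by linarith) (by linarith)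
    (by linarith) (fun t ht => h.ne_zero hσ ⟨ht.1, by linarith [ht.2]⟩ ht.2.ne)
    (Or.inr (h.left_deriv hL hσ)) (Or.inr h0) (fun s hs => (hg s (hsub1 hs)).mono hsub1)
    (hgc.mono hsub1) hφl hz
  have e2 := (h.ode.mono hsub2).energy_bound (φ := φ) (g := g) (by linarith) (by linarith)
    (by linarith) (fun t ht => h.ne_zero hσ ⟨by linarith [ht.1], ht.2⟩ ht.1.ne')
    (Or.inr h0) (Or.inr h.right_deriv.ne) (fun s hs => (hg s (hsub2 hs)).mono hsub2)
    (hgc.mono hsub2) hz hφr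
  have hsplit : ∀ f : ℝ → ℝ, ContinuousOn f (Icc (-(D / 2)) (D / 2)) →
      (∫ s in -(D / 2)..0, f s ^ 2 * cos s ^ (n - 1)) +
        ∫ s in (0)..D / 2, f s ^ 2 * cos s ^ (n - 1) =
      ∫ s in -(D / 2)..D / 2, f s ^ 2 * cos s ^ (n - 1) := by
    intro f hf
    have hf' : ContinuousOn (fun s => f s ^ 2 * cos s ^ (n - 1)) (Icc (-(D / 2)) (D / 2)) := by
      fun_prop
    exact intervalIntegral.integral_add_adjacent_intervals
      ((hf'.mono hsub1).intervalIntegrable_of_Icc (by linarith))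
      ((hf'.mono hsub2).intervalIntegrable_of_Icc hL.le)
  rw [← hsplit φ hφ.continuousOn, ← hsplit g hgc]
  linarith

lemma modelLam1_le_modelLam2 {n : ℕ} {D lam : ℝ} {y y' : ℝ → ℝ} (hD : 0 < D) (hD' : D < π)
    (h : ModelEigen (n - 1) (D / 2) (-1) lam y y') : modelLam1 n D ≤ lam := by
  have hL : 0 < D / 2 := by linarith
  refine csInf_le ⟨0, ?_⟩ ⟨y, ⟨h.contDiffOn hL, h.exists_ne_zero hL, h.left hL, h.right⟩,
    h.rayleighQ_eq hD hD'⟩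
  rintro _ ⟨φ, ⟨hφ, hφ0, -⟩, rfl⟩
  refine le_rayleighQ hD hD' hφ hφ0 fun g _ _ => ?_
  rw [zero_mul]
  refine intervalIntegral.integral_nonneg (by linarith) fun s hs => ?_
  exact mul_nonneg (sq_nonneg _)
    (pow_nonneg (cos_nonneg_of_mem_Icc ⟨by linarith [hs.1], by linarith [hs.2]⟩) _)

lemma tan_nonneg_of_mem {s : ℝ} (h0 : 0 ≤ s) (h1 : s < π / 2) : 0 ≤ tan s :=
  tan_nonneg_of_nonneg_of_le_pi_div_two h0 h1.le

lemma tan_le_tan_of_le {s t : ℝ} (h0 : 0 ≤ s) (h : s ≤ t) (h1 : t < π / 2) : tan s ≤ tan t :=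
  strictMonoOn_tan.monotoneOn ⟨by linarith, by linarith⟩ ⟨by linarith, h1⟩ h

/-- The rescaled first eigenvalue `L² λ₁` is nonincreasing in `L`. -/
lemma ModelEigen.sq_mul_antitone {m : ℕ} {L₁ L₂ lam₁ lam₂ : ℝ} {y₁ y₁' y₂ y₂' : ℝ → ℝ}
    (hL : 0 < L₁) (h12 : L₁ ≤ L₂) (hL₂ : L₂ < π / 2) (h₁ : ModelEigen m L₁ 1 lam₁ y₁ y₁')
    (h₂ : ModelEigen m L₂ 1 lam₂ y₂ y₂') (h0 : y₂ 0 ≠ 0) (hneg : ∀ t ∈ Icc 0 L₂, y₂' t ≤ 0) :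
    L₂ ^ 2 * lam₂ ≤ L₁ ^ 2 * lam₁ := by
  set κ : ℝ := L₂ / L₁ with hκdef
  have hκ1 : 1 ≤ κ := (one_le_div hL).2 h12
  have hκ0 : 0 < κ := by linarith
  have hκL : κ * L₁ = L₂ := div_mul_cancel₀ _ hL.ne'
  have hpos₂ : ∀ t ∈ Ico 0 L₂, 0 < y₂ t := by
    intro t ht
    have hnn : ∀ s ∈ Ioo 0 L₂, 0 < y₂ s := h₂.pos
    rcases ht.1.eq_or_lt with h | h
    · refine lt_of_le_of_ne ?_ (h ▸ h0.symm)
      have hc : Tendsto y₂ (𝓝[>] t) (𝓝 (y₂ t)) :=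
        (h₂.ode t ⟨by linarith [ht.1], ht.2.le⟩).1.continuousAt.continuousWithinAt
      refine ge_of_tendsto hc ?_
      filter_upwards [Ioo_mem_nhdsGT ht.2] with s hs using (hnn s ⟨h.le.trans_lt hs.1, hs.2⟩).le
    · exact hnn t ⟨h, ht.2⟩
  have hmem : ∀ {s}, s ∈ Icc (-L₁) L₁ → κ * s ∈ Icc (-L₂) L₂ := by
    intro s hs
    constructor <;> nlinarith [hs.1, hs.2]
  have hv := (h₂.ode.comp_mul κ).mono (S' := Icc (-L₁) L₁) fun s hs => hmem hs
  have hne : ∀ s ∈ Ioo (-L₁) L₁, y₂ (κ * s) ≠ 0 := by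
    intro s hs
    rcases eq_or_ne s 0 with h | h
    · rwa [h, mul_zero]
    · exact h₂.ne_zero one_ne_zero ⟨by nlinarith [hs.1], by nlinarith [hs.2]⟩
        (mul_ne_zero hκ0.ne' h)
  obtain ⟨ℓa, hℓa⟩ := hv.tendsto_logDeriv (c := -L₁) ⟨le_rfl, by linarith⟩
    (Or.inr (mul_ne_zero hκ0.ne' (by
      rw [mul_neg, hκL]; exact h₂.left_deriv (by linarith) one_ne_zero))) (Ioi (-L₁)) (by simp)
  obtain ⟨ℓb, hℓb⟩ := hv.tendsto_logDeriv (c := L₁) ⟨by linarith, le_rfl⟩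
    (Or.inr (mul_ne_zero hκ0.ne' (by rw [hκL]; exact h₂.right_deriv.ne))) (Iio L₁) (by simp)
  have hsign : ∀ s ∈ Ico 0 L₁, (κ * tan (κ * s) - tan s) * (y₂' (κ * s) / y₂ (κ * s)) ≤ 0 := by
    intro s hs
    have hs0 : 0 ≤ κ * s := mul_nonneg hκ0.le hs.1
    have hs1 : κ * s < L₂ := by nlinarith [hs.2]
    have h1 := tan_le_tan_of_le hs.1 (show s ≤ κ * s by nlinarith [hs.1]) (by linarith)
    have h2 := tan_nonneg_of_mem hs0 (by linarith)
    refine mul_nonpos_of_nonneg_of_nonpos (by nlinarith) ?_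
    exact div_nonpos_of_nonpos_of_nonneg (hneg _ ⟨hs0, hs1.le⟩) (hpos₂ _ ⟨hs0, hs1⟩).le
  have hsign' : ∀ s ∈ Ioo (-L₁) L₁,
      (κ * tan (κ * s) - tan s) * (y₂' (κ * s) / y₂ (κ * s)) ≤ 0 := by
    intro s hs
    rcases le_total 0 s with h | h
    · exact hsign s ⟨h, hs.2⟩
    · have h1 := hsign (-s) ⟨by linarith, by linarith [hs.1]⟩
      have hm := hmem (Ioo_subset_Icc_self hs)
      rw [mul_neg, tan_neg, tan_neg, h₂.symm _ hm, h₂.symm_deriv _ hm] at h1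
      calc _ = _ := ?_
        _ ≤ 0 := h1
      ring
  have key : κ ^ 2 * lam₂ ≤ lam₁ := h₁.ode.le_of_riccati (by linarith) (by linarith)
    (by linarith) (h₁.left hL) h₁.right (h₁.exists_ne_zero hL)
    (fun s hs => hv.hasDerivAt_logDeriv (Ioo_subset_Icc_self hs) (hne s hs)) (fun s hs => by
      have h1 := mul_nonneg (mul_nonneg (Nat.cast_nonneg (α := ℝ) m) hκ0.le)
        (neg_nonneg.2 (hsign' s hs))
      have h2 : κ * y₂' (κ * s) / y₂ (κ * s) = κ * (y₂' (κ * s) / y₂ (κ * s)) := mul_div_assoc ..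
      simp only [h2]
      linarith) hℓa hℓb
  calc L₂ ^ 2 * lam₂ = L₁ ^ 2 * (κ ^ 2 * lam₂) := by rw [← hκL]; ring
    _ ≤ _ := by gcongr

lemma nonpos_of_deriv_eq_mul_monotone {W c P : ℝ → ℝ} {a b : ℝ}
    (hW : ContinuousOn W (Icc a b)) (hd : ∀ s ∈ Ioo a b, HasDerivAt W (c s * P s) s)
    (hc : ∀ s ∈ Ioo a b, 0 < c s) (hP : MonotoneOn P (Ioo a b)) (ha : W a = 0) (hb : W b = 0) :
    ∀ s ∈ Ioo a b, W s ≤ 0 := by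
  intro s hs
  by_contra! hpos
  obtain ⟨r, hr, hr'⟩ := exists_hasDerivAt_eq_slope W (fun t => c t * P t) hs.1
    (hW.mono (Icc_subset_Icc_right hs.2.le)) fun t ht => hd t ⟨ht.1, ht.2.trans hs.2⟩
  obtain ⟨t, ht, ht'⟩ := exists_hasDerivAt_eq_slope W (fun t => c t * P t) hs.2
    (hW.mono (Icc_subset_Icc_left hs.1.le)) fun t ht => hd t ⟨hs.1.trans ht.1, ht.2⟩
  have hrm : r ∈ Ioo a b := ⟨hr.1, hr.2.trans hs.2⟩
  have htm : t ∈ Ioo a b := ⟨hs.1.trans ht.1, ht.2⟩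
  have h1 : 0 < c r * P r := by
    rw [hr', ha, sub_zero]; exact div_pos hpos (sub_pos.2 hs.1)
  have h2 : c t * P t < 0 := by
    rw [ht', hb, zero_sub]; exact div_neg_of_neg_of_pos (neg_neg_of_pos hpos) (sub_pos.2 hs.2)
  have h3 := hP hrm htm (hr.2.trans ht.1).le
  have h4 := pos_of_mul_pos_right h1 (hc r hrm).le
  nlinarith [mul_pos (hc t htm) (h4.trans_le h3)]

lemma hasDerivAt_mul_tan_mul {κ s : ℝ} (hs : κ * s ∈ Ioo (-(π / 2)) (π / 2)) :
    HasDerivAt (fun t => κ * tan (κ * t)) (κ ^ 2 * (1 + tan (κ * s) ^ 2)) s := by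
  have hm : HasDerivAt (fun t : ℝ => κ * t) κ s := by simpa using (hasDerivAt_id s).const_mul κ
  have hc := (cos_pos_of_mem_Ioo hs).ne'
  refine (((hasDerivAt_tan hc).comp s hm).const_mul κ).congr_deriv ?_
  rw [tan_eq_sin_div_cos]
  field_simp
  rw [cos_sq_add_sin_sq, mul_one]

/-- Sturm comparison of logarithmic derivatives for a common drift and a common zero. -/
lemma DriftODE.logDeriv_le {τ w v v' f f' : ℝ → ℝ} {μ₁ μ₂ a b : ℝ} (hab : a < b)
    (hv : DriftODE τ μ₁ (Icc a b) v v') (hf : DriftODE τ μ₂ (Icc a b) f f')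
    (hw : ∀ s ∈ Icc a b, HasDerivAt w (-τ s * w s) s) (hwpos : ∀ s ∈ Icc a b, 0 < w s)
    (hμ : μ₁ ≤ μ₂) (hvpos : ∀ s ∈ Ioo a b, 0 < v s) (hfpos : ∀ s ∈ Ioo a b, 0 < f s)
    (hvb : v b = 0) (hfb : f b = 0) : ∀ s ∈ Ioo a b, v' s / v s ≤ f' s / f s := by
  have hd : ∀ s ∈ Icc a b, HasDerivAt (fun t => w t * (f' t * v t - f t * v' t))
      (-(w s * (f s * v s) * (μ₂ - μ₁))) s := fun s hs => by
    refine ((hw s hs).mul (((hf s hs).2.mul (hv s hs).1).sub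
      ((hf s hs).1.mul (hv s hs).2))).congr_deriv ?_
    simp only [Pi.mul_apply, Pi.sub_apply]
    ring
  have hanti : AntitoneOn (fun t => w t * (f' t * v t - f t * v' t)) (Icc a b) := by
    refine antitoneOn_of_hasDerivWithinAt_nonpos (convex_Icc a b)
      (fun s hs => (hd s hs).continuousAt.continuousWithinAt)
      (fun s hs => (hd s (interior_subset hs)).hasDerivWithinAt) fun s hs => ?_
    have hs' := interior_subset hs
    rw [interior_Icc] at hs
    exact neg_nonpos.2 (mul_nonneg (mul_pos (hwpos s hs')
      (mul_pos (hfpos s hs) (hvpos s hs))).le (sub_nonneg.2 hμ))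
  intro s hs
  have hs' := Ioo_subset_Icc_self hs
  have h1 := hanti hs' ⟨hab.le, le_rfl⟩ hs.2.le
  simp only [hvb, hfb, mul_zero, zero_mul, sub_zero] at h1
  have h2 := nonneg_of_mul_nonneg_right h1 (hwpos s hs')
  rw [div_le_div_iff₀ (hvpos s hs) (hfpos s hs)]
  linarith

/-- Comparison of logarithmic derivatives of even ground states for two drifts `τ` and `ρ`. -/
lemma DriftODE.logDeriv_sub_le {τ τ' ρ ρ' w r u u' v v' : ℝ → ℝ} {lam μ a b : ℝ}
    (hu : DriftODE τ lam (Icc a b) u u') (hv : DriftODE ρ μ (Icc a b) v v')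
    (hτ : ∀ s ∈ Icc a b, HasDerivAt τ (τ' s) s) (hρ : ∀ s ∈ Icc a b, HasDerivAt ρ (ρ' s) s)
    (hw : ∀ s ∈ Icc a b, HasDerivAt w (-τ s * w s) s) (hwpos : ∀ s ∈ Icc a b, 0 < w s)
    (hr : ∀ s ∈ Icc a b, HasDerivAt r (-ρ s * r s) s) (hrpos : ∀ s ∈ Icc a b, 0 < r s)
    (hmono : MonotoneOn (fun s => (τ s ^ 2 - ρ s ^ 2) / 4 - (τ' s - ρ' s) / 2) (Icc a b))
    (hupos : ∀ s ∈ Ioo a b, 0 < u s) (hvpos : ∀ s ∈ Ioo a b, 0 < v s)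
    (hua : u' a = 0) (hva : v' a = 0) (hτρ : τ a = ρ a) (hub : u b = 0) (hvb : v b = 0) :
    ∀ s ∈ Ioo a b, u' s / u s - v' s / v s ≤ (τ s - ρ s) / 2 := by
  have he : ∀ s ∈ Icc a b, 0 < √(w s * r s) := fun s hs =>
    sqrt_pos.2 (mul_pos (hwpos s hs) (hrpos s hs))
  have hd : ∀ s ∈ Icc a b, HasDerivAt
      (fun t => √(w t * r t) * (u' t * v t - u t * v' t - u t * v t * ((τ t - ρ t) / 2)))
      (√(w s * r s) * (u s * v s) *
        (((τ s ^ 2 - ρ s ^ 2) / 4 - (τ' s - ρ' s) / 2) + (μ - lam))) s := by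
    intro s hs
    have he1 : HasDerivAt (fun t => √(w t * r t)) (-((τ s + ρ s) / 2) * √(w s * r s)) s := by
      refine (((hw s hs).mul (hr s hs)).sqrt
        (mul_pos (hwpos s hs) (hrpos s hs)).ne').congr_deriv ?_
      rw [Pi.mul_apply, div_eq_iff (mul_pos two_pos (he s hs)).ne']
      have := mul_self_sqrt (mul_pos (hwpos s hs) (hrpos s hs)).le
      linear_combination (τ s + ρ s) * this
    refine (he1.mul ((((hu s hs).2.mul (hv s hs).1).sub ((hu s hs).1.mul (hv s hs).2)).sub
      (((hu s hs).1.mul (hv s hs).1).mul (((hτ s hs).sub (hρ s hs)).div_const 2)))).congr_deriv ?_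
    simp only [Pi.mul_apply, Pi.sub_apply]
    ring
  have hW := nonpos_of_deriv_eq_mul_monotone
    (fun s hs => (hd s hs).continuousAt.continuousWithinAt)
    (fun s hs => hd s (Ioo_subset_Icc_self hs))
    (fun s hs => mul_pos (he s (Ioo_subset_Icc_self hs)) (mul_pos (hupos s hs) (hvpos s hs)))
    ((hmono.mono Ioo_subset_Icc_self).add_const _) (by simp [hua, hva, hτρ]) (by simp [hub, hvb])
  intro s hs
  have h1 := nonpos_of_mul_nonpos_right (hW s hs) (he s (Ioo_subset_Icc_self hs))
  have hus := hupos s hs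
  have hvs := hvpos s hs
  rw [div_sub_div _ _ hus.ne' hvs.ne', div_le_iff₀ (mul_pos hus hvs)]
  linarith

lemma monotoneOn_tan_potential {m : ℕ} (hm : 2 ≤ m) {κ b : ℝ} (hκ0 : 0 < κ) (hκ1 : κ ≤ 1)
    (hb : b < π / 2) :
    MonotoneOn (fun s => ((m * tan s) ^ 2 - (κ * (m * tan (κ * s))) ^ 2) / 4 -
      (m * (1 + tan s ^ 2) - m * (κ ^ 2 * (1 + tan (κ * s) ^ 2))) / 2) (Icc 0 b) := by
  have hm' : (2 : ℝ) ≤ m := by exact_mod_cast hm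
  have hκs : ∀ s ∈ Icc 0 b, 0 ≤ κ * s ∧ κ * s ≤ s := fun s hs =>
    ⟨mul_nonneg hκ0.le hs.1, by nlinarith [hs.1]⟩
  have hd1 : ∀ s ∈ Icc 0 b, HasDerivAt (fun t => tan t) (1 + tan s ^ 2) s := fun s hs => by
    simpa using hasDerivAt_mul_tan_mul (κ := 1) (s := s)
      ⟨by linarith [hs.1, pi_pos], by linarith [hs.2]⟩
  have hd2 : ∀ s ∈ Icc 0 b,
      HasDerivAt (fun t => κ * tan (κ * t)) (κ ^ 2 * (1 + tan (κ * s) ^ 2)) s := fun s hs =>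
    hasDerivAt_mul_tan_mul ⟨by linarith [(hκs s hs).1, pi_pos], by linarith [(hκs s hs).2, hs.2]⟩
  have hd : ∀ s ∈ Icc 0 b, HasDerivAt (fun t => tan t ^ 2 - (κ * tan (κ * t)) ^ 2)
      (2 * (tan s * (1 + tan s ^ 2) -
        κ * tan (κ * s) * (κ ^ 2 * (1 + tan (κ * s) ^ 2)))) s := fun s hs => by
    refine (((hd1 s hs).pow 2).sub ((hd2 s hs).pow 2)).congr_deriv ?_
    simp only [Nat.cast_ofNat, Nat.add_one_sub_one, pow_one]
    ring
  have hR : MonotoneOn (fun t => tan t ^ 2 - (κ * tan (κ * t)) ^ 2) (Icc 0 b) := by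
    refine monotoneOn_of_hasDerivWithinAt_nonneg (convex_Icc 0 b)
      (fun s hs => (hd s hs).continuousAt.continuousWithinAt)
      (fun s hs => (hd s (interior_subset hs)).hasDerivWithinAt) fun s hs => ?_
    have hs' := interior_subset hs
    obtain ⟨h1, h2⟩ := hκs s hs'
    have h3 := tan_nonneg_of_mem h1 (by linarith [hs'.2])
    have h4 := tan_le_tan_of_le h1 h2 (by linarith [hs'.2])
    have h5 : κ * tan (κ * s) * (κ ^ 2 * (1 + tan (κ * s) ^ 2)) ≤ tan s * (1 + tan s ^ 2) := by
      refine mul_le_mul (by nlinarith) ?_ (by positivity) (h3.trans h4)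
      calc κ ^ 2 * (1 + tan (κ * s) ^ 2) ≤ 1 * (1 + tan s ^ 2) := by
            gcongr
            nlinarith
        _ = _ := one_mul _
    linarith
  have heq : ∀ s, ((m * tan s) ^ 2 - (κ * (m * tan (κ * s))) ^ 2) / 4 -
      (m * (1 + tan s ^ 2) - m * (κ ^ 2 * (1 + tan (κ * s) ^ 2))) / 2 =
      (m * (m - 2) / 4 : ℝ) * (tan s ^ 2 - (κ * tan (κ * s)) ^ 2) - m / 2 * (1 - κ ^ 2) :=
    fun s => by ring
  intro s hs t ht hst
  have h1 := hR hs ht hst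
  have h2 : (0 : ℝ) ≤ m * (m - 2) / 4 := by
    have : (0 : ℝ) ≤ m - 2 := by linarith
    positivity
  simp only [heq] at h1 ⊢
  linarith [mul_le_mul_of_nonneg_left h1 h2]

/-- The rescaled spectral gap `L² (λ₂ - λ₁)` is nondecreasing in `L`. -/
lemma ModelEigen.gap_monotone {m : ℕ} (hm : 2 ≤ m) {L₁ L₂ lam₁ lam₂ nu₁ nu₂ : ℝ}
    {v v' f f' u u' h h' : ℝ → ℝ} (hL : 0 < L₁) (h12 : L₁ ≤ L₂) (hL₂ : L₂ < π / 2)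
    (hv : ModelEigen m L₁ 1 lam₁ v v') (hv0 : v 0 = 1) (hv'0 : v' 0 = 0)
    (hf : ModelEigen m L₁ (-1) lam₂ f f') (hf'0 : f' 0 ≠ 0) (hlam : lam₁ ≤ lam₂)
    (hu : ModelEigen m L₂ 1 nu₁ u u') (hu0 : u 0 = 1) (hu'0 : u' 0 = 0)
    (hh : ModelEigen m L₂ (-1) nu₂ h h') (hh0 : h 0 = 0) :
    L₁ ^ 2 * (lam₂ - lam₁) ≤ L₂ ^ 2 * (nu₂ - nu₁) := by
  have hL₂0 : 0 < L₂ := hL.trans_le h12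
  set κ : ℝ := L₁ / L₂ with hκdef
  have hκ0 : 0 < κ := div_pos hL hL₂0
  have hκ1 : κ ≤ 1 := (div_le_one hL₂0).2 h12
  have hκL : κ * L₂ = L₁ := div_mul_cancel₀ _ hL₂0.ne'
  have hmem : ∀ {s}, s ∈ Icc 0 L₂ → κ * s ∈ Icc (-L₁) L₁ := fun hs =>
    ⟨by nlinarith [hs.1], by nlinarith [hs.2]⟩
  have hmem' : ∀ {s}, s ∈ Ioo 0 L₂ → κ * s ∈ Ioo 0 L₁ := fun hs =>
    ⟨mul_pos hκ0 hs.1, by nlinarith [hs.2]⟩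
  have hsub : Icc 0 L₂ ⊆ Icc (-L₂) L₂ := Icc_subset_Icc_left (by linarith)
  have hl : (0 : ℝ) ∈ Icc 0 L₂ := ⟨le_rfl, hL₂0.le⟩
  have hr : L₂ ∈ Icc 0 L₂ := ⟨hL₂0.le, le_rfl⟩
  have ou := hu.ode.mono hsub
  have ov := (hv.ode.comp_mul κ).mono (S' := Icc 0 L₂) fun s hs => hmem hs
  have of := (hf.ode.comp_mul κ).mono (S' := Icc 0 L₂) fun s hs => hmem hs
  have hvpos : ∀ s ∈ Ioo 0 L₂, 0 < v (κ * s) := fun s hs => hv.pos _ (hmem' hs)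
  have hfpos : ∀ s ∈ Ioo 0 L₂, 0 < f (κ * s) := fun s hs => hf.pos _ (hmem' hs)
  have hπ : ∀ s ∈ Icc 0 L₂, s ∈ Ioo (-(π / 2)) (π / 2) := fun s hs =>
    ⟨by linarith [hs.1], by linarith [hs.2]⟩
  have hπ' : ∀ s ∈ Icc 0 L₂, κ * s ∈ Ioo (-(π / 2)) (π / 2) := fun s hs =>
    ⟨by linarith [(hmem hs).1], by linarith [(hmem hs).2]⟩
  have hw : ∀ s ∈ Icc 0 L₂, HasDerivAt (fun t => cos (κ * t) ^ m)
      (-(κ * (m * tan (κ * s))) * cos (κ * s) ^ m) s := fun s hs => by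
    have hmul : HasDerivAt (fun t : ℝ => κ * t) κ s := by
      simpa using (hasDerivAt_id s).const_mul κ
    exact ((hasDerivAt_cos_pow m (hπ' s hs)).comp s hmul).congr_deriv (by ring)
  have hβ := ov.logDeriv_le hL₂0 of hw (fun s hs => pow_pos (cos_pos_of_mem_Ioo (hπ' s hs)) m)
    (mul_le_mul_of_nonneg_left hlam (sq_nonneg κ)) hvpos hfpos (by rw [hκL, hv.right])
    (by rw [hκL, hf.right])
  have hUV := ou.logDeriv_sub_le ov (τ' := fun s => m * (1 + tan s ^ 2))
    (ρ' := fun s => m * (κ ^ 2 * (1 + tan (κ * s) ^ 2)))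
    (fun s hs => by
      have := hasDerivAt_mul_tan_mul (κ := 1) (s := s) (by simpa using hπ s hs)
      simpa using this.const_mul (m : ℝ))
    (fun s hs => by
      have := (hasDerivAt_mul_tan_mul (hπ' s hs)).const_mul (m : ℝ)
      simpa only [mul_left_comm (m : ℝ) κ] using this)
    (fun s hs => hasDerivAt_cos_pow m (hπ s hs))
    (fun s hs => pow_pos (cos_pos_of_mem_Ioo (hπ s hs)) m) hw
    (fun s hs => pow_pos (cos_pos_of_mem_Ioo (hπ' s hs)) m)
    (monotoneOn_tan_potential hm hκ0 hκ1 hL₂) hu.pos hvpos hu'0 (by simp [hv'0]) (by simp)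
    hu.right (by rw [hκL, hv.right])
  have hlim : ∀ c ∈ Icc 0 L₂, ∀ A : Set ℝ, c ∉ A → (u c ≠ 0 ∨ u' c ≠ 0) →
      (v (κ * c) ≠ 0 ∨ κ * v' (κ * c) ≠ 0) → (f (κ * c) ≠ 0 ∨ κ * f' (κ * c) ≠ 0) →
      ∃ ℓ, Tendsto (fun s => (u' s / u s + κ * f' (κ * s) / f (κ * s) -
        κ * v' (κ * s) / v (κ * s)) * (s - c)) (𝓝[A] c) (𝓝 ℓ) := by
    intro c hc A hA h1 h2 h3
    obtain ⟨x, hx⟩ := ou.tendsto_logDeriv hc h1 A hA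
    obtain ⟨y, hy⟩ := ov.tendsto_logDeriv hc h2 A hA
    obtain ⟨z, hz⟩ := of.tendsto_logDeriv hc h3 A hA
    exact ⟨x + z - y, ((hx.add hz).sub hy).congr fun s => by ring⟩
  obtain ⟨ℓa, hℓa⟩ := hlim 0 hl (Ioi 0) (by simp) (by simp [hu0]) (by simp [hv0])
    (Or.inr (by simpa using ⟨hκ0.ne', hf'0⟩))
  obtain ⟨ℓb, hℓb⟩ := hlim L₂ hr (Iio L₂) (by simp) (Or.inr hu.right_deriv.ne)
    (Or.inr (by rw [hκL]; exact mul_ne_zero hκ0.ne' hv.right_deriv.ne))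
    (Or.inr (by rw [hκL]; exact mul_ne_zero hκ0.ne' hf.right_deriv.ne))
  have key : nu₁ + κ ^ 2 * lam₂ - κ ^ 2 * lam₁ ≤ nu₂ :=
    (hh.ode.mono hsub).le_of_riccati hL₂0 (by linarith) hL₂ hh0 hh.right
      ⟨L₂ / 2, ⟨by linarith, by linarith⟩, (hh.pos _ ⟨by linarith, by linarith⟩).ne'⟩
      (fun s hs => ((ou.hasDerivAt_logDeriv (Ioo_subset_Icc_self hs) (hu.pos s hs).ne').add
        (of.hasDerivAt_logDeriv (Ioo_subset_Icc_self hs) (hfpos s hs).ne')).sub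
        (ov.hasDerivAt_logDeriv (Ioo_subset_Icc_self hs) (hvpos s hs).ne'))
      (fun s hs => by
        have h1 := sub_nonneg.2 (hβ s hs)
        have h2 := sub_nonneg.2 (hUV s hs)
        simp only [Pi.add_apply, Pi.sub_apply]
        linarith [mul_nonneg h1 h2]) hℓa hℓb
  calc L₁ ^ 2 * (lam₂ - lam₁) = L₂ ^ 2 * (κ ^ 2 * lam₂ - κ ^ 2 * lam₁) := by
        rw [← hκL]; ring
    _ ≤ _ := mul_le_mul_of_nonneg_left (by linarith) (sq_nonneg _)

/-- For `n ≥ 3`, the ratio `λ̄₂(n,D)/λ̄₁(n,D)` is monotone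
nondecreasing in `D` on `(0, π)`. -/
theorem model_ratio_monotone (n : ℕ) (hn : 3 ≤ n) (D₁ D₂ : ℝ)
    (h1 : 0 < D₁) (h12 : D₁ ≤ D₂) (h2 : D₂ < π) :
    modelLam2 n D₁ / modelLam1 n D₁ ≤ modelLam2 n D₂ / modelLam1 n D₂ := by
  have hD₂ : 0 < D₂ := h1.trans_le h12
  have hD₁ : D₁ < π := h12.trans_lt h2
  obtain ⟨lam₁, v, v', hv, hlam₁, hv0, hv'0, -⟩ :=
    exists_even_eigen (n - 1) (show 0 < D₁ / 2 by linarith) (by linarith)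
  obtain ⟨lam₂, f, f', hf, -, hf'0⟩ :=
    exists_odd_eigen (n - 1) (show 0 < D₁ / 2 by linarith) (by linarith)
  obtain ⟨nu₁, u, u', hu, hnu₁, hu0, hu'0, hneg⟩ :=
    exists_even_eigen (n - 1) (show 0 < D₂ / 2 by linarith) (by linarith)
  obtain ⟨nu₂, h, h', hh, hh0, hh'0⟩ :=
    exists_odd_eigen (n - 1) (show 0 < D₂ / 2 by linarith) (by linarith)
  have hle := modelLam1_le_modelLam2 h1 hD₁ hf
  rw [hv.modelLam1_eq h1 hD₁ (by simp [hv0])] at hle ⊢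
  rw [hf.modelLam2_eq h1 hD₁ (by simp [hf'0]), hu.modelLam1_eq hD₂ h2 (by simp [hu0]),
    hh.modelLam2_eq hD₂ h2 (by simp [hh'0])]
  have hmul := hv.sq_mul_antitone (by linarith) (by linarith) (by linarith) hu (by simp [hu0]) hneg
  have hgap := ModelEigen.gap_monotone (by omega) (by linarith) (by linarith) (by linarith)
    hv hv0 hv'0 hf (by simp [hf'0]) hle hu hu0 hu'0 hh hh0
  have hgap0 : 0 ≤ (D₁ / 2) ^ 2 * (lam₂ - lam₁) := mul_nonneg (sq_nonneg _) (sub_nonneg.2 hle)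
  have hden : 0 < (D₂ / 2) ^ 2 * nu₁ := by positivity
  have e₁ : lam₂ / lam₁ = 1 + (D₁ / 2) ^ 2 * (lam₂ - lam₁) / ((D₁ / 2) ^ 2 * lam₁) := by
    field_simp
    ring
  have e₂ : nu₂ / nu₁ = 1 + (D₂ / 2) ^ 2 * (nu₂ - nu₁) / ((D₂ / 2) ^ 2 * nu₁) := by
    field_simp
    ring
  rw [e₁, e₂]
  gcongr
  exact hgap0.trans hgap
end
end

section
/- Let n ≥ 1 be an integer, 0 < D < π, and let φ̄₁ : [−D/2, D/2] → ℝ be a C² function that is even, positive on (−D/2, D/2), vanishes at ±D/2, and satisfies φ̄₁''(s) − (n−1)tan(s)·φ̄₁'(s) + λ̄₁·φ̄₁(s) = 0 on (−D/2, D/2) for some λ̄₁ > 0. Then φ̄₁'(s) < 0 for every s ∈ (0, D/2]; in particular φ̄₁ is strictly decreasing on [0, D/2]. -/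
open Real Set

noncomputable section

/-- The derivative at the origin of a function that is even near the origin vanishes. -/
theorem hasDerivAt_zero_eq_zero_of_even {f : ℝ → ℝ} {c : ℝ} (hf : HasDerivAt f c 0)
    (heven : ∀ᶠ s in nhds (0 : ℝ), f (-s) = f s) : c = 0 := by
  have h1 : HasDerivAt (fun s => f (-s)) (-c) 0 := by
    have h := HasDerivAt.comp (0 : ℝ) (h₂ := f) (by simpa using hf) (hasDerivAt_neg (0 : ℝ))
    simpa [Function.comp_def] using h
  have h2 := (h1.congr_of_eventuallyEq (heven.mono fun _ h => h.symm)).unique hf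
  linarith

/-- The weight `cos ^ m` turns `g' - m tan(s) g` into an exact derivative. -/
theorem hasDerivAt_cos_pow_mul {g : ℝ → ℝ} {d s : ℝ} (m : ℕ) (hg : HasDerivAt g d s)
    (hs : Real.cos s ≠ 0) :
    HasDerivAt (fun t => Real.cos t ^ m * g t)
      (Real.cos s ^ m * (d - (m : ℝ) * Real.tan s * g s)) s := by
  refine (((Real.hasDerivAt_cos s).fun_pow m).mul hg).congr_deriv ?_
  rw [Real.tan_eq_sin_div_cos]
  cases m with
  | zero => simp
  | succ k =>
    simp only [Nat.add_sub_cancel, pow_succ]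
    field_simp
    ring

/-- A first model eigenfunction (even, positive, vanishing at the
endpoints, with eigenvalue `λ̄₁ > 0`) has `φ̄₁' < 0` on `(0, D/2]`; in particular it is
strictly decreasing on `[0, D/2]`. Here `φ'` and `φ''` are the first and second
derivatives of `φ` on `[−D/2, D/2]` (derivatives within the interval). -/
theorem first_model_eigenfunction_decreasing (n : ℕ) (hn : 1 ≤ n) (D lam : ℝ)
    (hD0 : 0 < D) (hDpi : D < π)
    (φ φ' φ'' : ℝ → ℝ)
    (hd1 : ∀ s ∈ Set.Icc (-(D/2)) (D/2), HasDerivWithinAt φ (φ' s) (Set.Icc (-(D/2)) (D/2)) s)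
    (hd2 : ∀ s ∈ Set.Icc (-(D/2)) (D/2), HasDerivWithinAt φ' (φ'' s) (Set.Icc (-(D/2)) (D/2)) s)
    (hc : ContinuousOn φ'' (Set.Icc (-(D/2)) (D/2)))
    (heven : ∀ s ∈ Set.Icc (-(D/2)) (D/2), φ (-s) = φ s)
    (hpos : ∀ s ∈ Set.Ioo (-(D/2)) (D/2), 0 < φ s)
    (hbd : φ (D/2) = 0) (hbd' : φ (-(D/2)) = 0)
    (hlam : 0 < lam)
    (hode : ∀ s ∈ Set.Ioo (-(D/2)) (D/2),
      φ'' s - ((n : ℝ) - 1) * Real.tan s * φ' s + lam * φ s = 0) :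
    (∀ s, 0 < s → s ≤ D/2 → φ' s < 0) ∧ StrictAntiOn φ (Set.Icc 0 (D/2)) := by
  have hIoo : ∀ s ∈ Set.Ioo (-(D/2)) (D/2), Set.Icc (-(D/2)) (D/2) ∈ nhds s :=
    fun s hs => Icc_mem_nhds hs.1 hs.2
  have h0 : (0 : ℝ) ∈ Set.Ioo (-(D/2)) (D/2) := ⟨by linarith, by linarith⟩
  have hcos : ∀ s ∈ Set.Icc 0 (D/2), 0 < Real.cos s := fun s hs =>
    Real.cos_pos_of_mem_Ioo ⟨by linarith [hs.1, Real.pi_pos], by linarith [hs.2]⟩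
  have hsub : Set.Icc 0 (D/2) ⊆ Set.Icc (-(D/2)) (D/2) :=
    Set.Icc_subset_Icc_left (by linarith)
  have hφ0 : φ' 0 = 0 :=
    hasDerivAt_zero_eq_zero_of_even ((hd1 0 (Ioo_subset_Icc_self h0)).hasDerivAt (hIoo 0 h0))
      (Filter.mem_of_superset (hIoo 0 h0) heven)
  obtain ⟨m, rfl⟩ : ∃ m, n = m + 1 := ⟨n - 1, by omega⟩
  have hanti : StrictAntiOn (fun t => Real.cos t ^ m * φ' t) (Set.Icc 0 (D/2)) := by
    refine strictAntiOn_of_hasDerivWithinAt_neg (convex_Icc _ _)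
      (f' := fun s => Real.cos s ^ m * (φ'' s - (m : ℝ) * Real.tan s * φ' s)) ?_ ?_ ?_
    · exact (Real.continuous_cos.pow m).continuousOn.mul
        fun s hs => ((hd2 s (hsub hs)).mono hsub).continuousWithinAt
    · intro s hs
      rw [interior_Icc] at hs
      have hs' : s ∈ Set.Ioo (-(D/2)) (D/2) := ⟨by linarith [hs.1], hs.2⟩
      exact (hasDerivAt_cos_pow_mul m
        ((hd2 s (Ioo_subset_Icc_self hs')).hasDerivAt (hIoo s hs'))
        (hcos s (Ioo_subset_Icc_self hs)).ne').hasDerivWithinAt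
    · intro s hs
      rw [interior_Icc] at hs
      have hs' : s ∈ Set.Ioo (-(D/2)) (D/2) := ⟨by linarith [hs.1], hs.2⟩
      have hode' := hode s hs'
      push_cast at hode'
      rw [add_sub_cancel_right] at hode'
      exact mul_neg_of_pos_of_neg (pow_pos (hcos s (Ioo_subset_Icc_self hs)) m)
        (by linarith [mul_pos hlam (hpos s hs')])
  have hneg : ∀ s, 0 < s → s ≤ D/2 → φ' s < 0 := by
    intro s hs hsD
    have h := hanti ⟨le_rfl, by linarith⟩ ⟨hs.le, hsD⟩ hs
    simp only [hφ0, mul_zero] at h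
    exact (pos_iff_neg_of_mul_neg h).1 (pow_pos (hcos s ⟨hs.le, hsD⟩) m)
  refine ⟨hneg, strictAntiOn_of_hasDerivWithinAt_neg (convex_Icc _ _) (f' := φ') ?_ ?_ ?_⟩
  · exact fun s hs => ((hd1 s (hsub hs)).mono hsub).continuousWithinAt
  · exact fun s hs => (hd1 s (hsub (interior_subset hs))).mono (interior_subset.trans hsub)
  · intro s hs
    rw [interior_Icc] at hs
    exact hneg s hs.1 hs.2.le
end
end

section
/- Let n ≥ 1 be an integer, 0 < D < π, and let φ̄₁ be a first model eigenfunction on [−D/2, D/2] with eigenvalue λ̄₁ > 0 (even, positive on (−D/2, D/2)). Let f = φ̄₁'/φ̄₁ on (−D/2, D/2). Then f satisfies, on (−D/2, D/2), the equation f'' + 2·f·f' − tan(s)·[(n+1)·f' + 2·λ̄₁ + 2·f²] − (n−1)·(1 − tan²(s))·f = 0. -/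
open Real Set

noncomputable section

/-- The logarithmic derivative of a solution of `φ'' - c t φ' + l φ = 0` solves the Riccati equation
`f' = -f² + c t f - l`. -/
theorem hasDerivAt_logDeriv_of_ode {φ : ℝ → ℝ} {c t l x : ℝ}
    (hφ : DifferentiableAt ℝ φ x) (hφ' : DifferentiableAt ℝ (deriv φ) x) (hx : φ x ≠ 0)
    (hode : deriv (deriv φ) x - c * t * deriv φ x + l * φ x = 0) :
    HasDerivAt (fun a => deriv φ a / φ a)
      (-(deriv φ x / φ x) ^ 2 + c * t * (deriv φ x / φ x) - l) x := by
  refine (hφ'.hasDerivAt.div hφ.hasDerivAt hx).congr_deriv ?_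
  have h : deriv (deriv φ) x = c * t * deriv φ x - l * φ x := by linarith
  rw [h]
  field_simp
  ring

/-- For a first model eigenfunction `φ̄₁` with eigenvalue `λ̄₁ > 0`,
the function `f = φ̄₁'/φ̄₁` satisfies on `(−D/2, D/2)`:
`f'' + 2·f·f' − tan(s)·[(n+1)·f' + 2·λ̄₁ + 2·f²] − (n−1)·(1 − tan²(s))·f = 0`. -/
theorem log_derivative_ode (n : ℕ) (hn : 1 ≤ n) (D lam : ℝ)
    (hD0 : 0 < D) (hDpi : D < π)
    (φ : ℝ → ℝ)
    (hcont : ContinuousOn φ (Set.Icc (-(D/2)) (D/2)))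
    (hsmooth : ContDiffOn ℝ (⊤ : ℕ∞) φ (Set.Ioo (-(D/2)) (D/2)))
    (heven : ∀ s ∈ Set.Icc (-(D/2)) (D/2), φ (-s) = φ s)
    (hpos : ∀ s ∈ Set.Ioo (-(D/2)) (D/2), 0 < φ s)
    (hbd : φ (D/2) = 0) (hbd' : φ (-(D/2)) = 0)
    (hlam : 0 < lam)
    (hode : ∀ s ∈ Set.Ioo (-(D/2)) (D/2),
      deriv (deriv φ) s - ((n : ℝ) - 1) * Real.tan s * deriv φ s + lam * φ s = 0) :
    ∀ s ∈ Set.Ioo (-(D/2)) (D/2),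
      deriv (deriv (fun a => deriv φ a / φ a)) s
        + 2 * (deriv φ s / φ s) * deriv (fun a => deriv φ a / φ a) s
        - Real.tan s * (((n : ℝ) + 1) * deriv (fun a => deriv φ a / φ a) s
            + 2 * lam + 2 * (deriv φ s / φ s) ^ 2)
        - ((n : ℝ) - 1) * (1 - Real.tan s ^ 2) * (deriv φ s / φ s) = 0 := by
  have riccati : ∀ x ∈ Ioo (-(D/2)) (D/2), HasDerivAt (fun a => deriv φ a / φ a)
      (-(deriv φ x / φ x) ^ 2 + ((n : ℝ) - 1) * Real.tan x * (deriv φ x / φ x) - lam) x := by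
    intro x hx
    have hnhds : Ioo (-(D/2)) (D/2) ∈ nhds x := isOpen_Ioo.mem_nhds hx
    have hφ' : ContDiffOn ℝ 1 (deriv φ) (Ioo (-(D/2)) (D/2)) :=
      (contDiffOn_infty.1 hsmooth 2).deriv_of_isOpen isOpen_Ioo (by norm_num)
    exact hasDerivAt_logDeriv_of_ode ((hsmooth.contDiffAt hnhds).differentiableAt (by simp))
      ((hφ'.contDiffAt hnhds).differentiableAt (by simp)) (hpos x hx).ne' (hode x hx)
  intro s hs
  have hcos : Real.cos s ≠ 0 :=
    (Real.cos_pos_of_mem_Ioo ⟨by linarith [hs.1], by linarith [hs.2]⟩).ne'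
  have htan : HasDerivAt Real.tan (1 + Real.tan s ^ 2) s := by
    refine (Real.hasDerivAt_tan hcos).congr_deriv ?_
    rw [one_div, ← Real.inv_one_add_tan_sq hcos, inv_inv]
  have hf := riccati s hs
  have heq : deriv (fun a => deriv φ a / φ a) =ᶠ[nhds s] fun x =>
      -(deriv φ x / φ x) ^ 2 + ((n : ℝ) - 1) * Real.tan x * (deriv φ x / φ x) - lam := by
    filter_upwards [isOpen_Ioo.mem_nhds hs] with x hx using (riccati x hx).deriv
  have hf' := (((hf.pow 2).neg.add ((htan.const_mul ((n : ℝ) - 1)).mul hf)).sub_const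
    lam).congr_of_eventuallyEq heq
  rw [hf'.deriv, hf.deriv]
  simp only [Nat.cast_ofNat, Nat.add_one_sub_one, pow_one]
  ring
end
end

section
/- Let n ≥ 1 be an integer, 0 < D < π. Let φ̄₁ be a first model eigenfunction on [−D/2, D/2] (even, positive on (−D/2, D/2)) and φ̄₂ a second model eigenfunction (odd, with φ̄₂ > 0 on (0, D/2)). Assume the quotient φ̄₂/φ̄₁ is monotone nondecreasing on [0, D/2), and assume the normalization ∫₀^{D/2} φ̄₁(s)² cos^{n−1}(s) ds = ∫₀^{D/2} φ̄₂(s)² cos^{n−1}(s) ds. Then there exists a unique b ∈ (0, D/2) with φ̄₁(b) = φ̄₂(b); moreover φ̄₂(s) ≤ φ̄₁(s) for s ∈ [0, b] and φ̄₂(s) ≥ φ̄₁(s) for s ∈ [b, D/2]. -/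
open Real Set

noncomputable section

/-- A `C²` function on an open set has derivative `deriv f` there, which is itself
differentiable with derivative `deriv (deriv f)`. -/
theorem hasDerivAt_and_hasDerivAt_deriv_of_contDiffOn_two {f : ℝ → ℝ} {U : Set ℝ}
    (hU : IsOpen U) (hf : ContDiffOn ℝ 2 f U) {s : ℝ} (hs : s ∈ U) :
    HasDerivAt f (deriv f s) s ∧ HasDerivAt (deriv f) (deriv (deriv f) s) s := by
  have h1 : ContDiffOn ℝ 1 (deriv f) U := hf.deriv_of_isOpen hU (by norm_num)
  exact ⟨((hf.differentiableOn (by norm_num)).differentiableAt (hU.mem_nhds hs)).hasDerivAt,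
    ((h1.differentiableOn (by norm_num)).differentiableAt (hU.mem_nhds hs)).hasDerivAt⟩

/-- The derivative of the weighted Wronskian `cos^m (g' f - g f')` of two solutions of the
model equation. -/
theorem hasDerivAt_weighted_wronskian {f g f' g' : ℝ → ℝ} {f'' g'' a b s : ℝ} {m : ℕ}
    (hf : HasDerivAt f (f' s) s) (hf' : HasDerivAt f' f'' s)
    (hg : HasDerivAt g (g' s) s) (hg' : HasDerivAt g' g'' s) (hcos : Real.cos s ≠ 0)
    (hfode : f'' - (m : ℝ) * Real.tan s * f' s + a * f s = 0)
    (hgode : g'' - (m : ℝ) * Real.tan s * g' s + b * g s = 0) :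
    HasDerivAt (fun x => Real.cos x ^ m * (g' x * f x - g x * f' x))
      ((a - b) * (Real.cos s ^ m * (f s * g s))) s := by
  have hpow : HasDerivAt (fun x => Real.cos x ^ m)
      (-((m : ℝ) * Real.tan s * Real.cos s ^ m)) s := by
    refine ((Real.hasDerivAt_cos s).fun_pow m).congr_deriv ?_
    rw [Real.tan_eq_sin_div_cos]
    cases m with
    | zero => simp
    | succ k =>
      field_simp
      simp only [Nat.add_sub_cancel]
      ring
  refine (hpow.fun_mul ((hg'.fun_mul hf).fun_sub (hg.fun_mul hf'))).congr_deriv ?_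
  linear_combination Real.cos s ^ m * (f s * hgode - g s * hfode)

/-- If two solutions of the model equation agree near a point where `f` does not vanish, then
their ratio is constant on the whole interval. -/
theorem ratio_eq_one_of_eventuallyEq {f g : ℝ → ℝ} {a b R : ℝ} {m : ℕ} (hR : R < π / 2)
    (hf : ContDiffOn ℝ 2 f (Ioo (-R) R)) (hg : ContDiffOn ℝ 2 g (Ioo (-R) R))
    (hfpos : ∀ s ∈ Ioo (-R) R, 0 < f s)
    (hfode : ∀ s ∈ Ioo (-R) R,
      deriv (deriv f) s - (m : ℝ) * Real.tan s * deriv f s + a * f s = 0)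
    (hgode : ∀ s ∈ Ioo (-R) R,
      deriv (deriv g) s - (m : ℝ) * Real.tan s * deriv g s + b * g s = 0)
    {c : ℝ} (hc : c ∈ Ioo (-R) R) (hfg : f =ᶠ[nhds c] g) :
    ∀ s ∈ Ioo (-R) R, g s / f s = 1 := by
  have hcos : ∀ s ∈ Ioo (-R) R, 0 < Real.cos s := fun s hs =>
    Real.cos_pos_of_mem_Ioo ⟨by linarith [hs.1], by linarith [hs.2]⟩
  have hab : a = b := by
    have h1 := hfode c hc
    have h2 := hgode c hc
    rw [← hfg.deriv.deriv_eq, ← hfg.deriv_eq, ← hfg.eq_of_nhds] at h2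
    have h3 : (a - b) * f c = 0 := by linear_combination h1 - h2
    rcases mul_eq_zero.mp h3 with h | h
    · linarith
    · exact absurd h (hfpos c hc).ne'
  set W : ℝ → ℝ := fun x => Real.cos x ^ m * (deriv g x * f x - g x * deriv f x) with hW
  have hWd : ∀ s ∈ Ioo (-R) R, HasDerivAt W 0 s := by
    intro s hs
    obtain ⟨f1, f2⟩ := hasDerivAt_and_hasDerivAt_deriv_of_contDiffOn_two isOpen_Ioo hf hs
    obtain ⟨g1, g2⟩ := hasDerivAt_and_hasDerivAt_deriv_of_contDiffOn_two isOpen_Ioo hg hs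
    have := hasDerivAt_weighted_wronskian f1 f2 g1 g2 (hcos s hs).ne' (hfode s hs) (hgode s hs)
    rwa [hab, sub_self, zero_mul] at this
  have hWc : W c = 0 := by
    simp only [hW]
    rw [← hfg.deriv_eq, ← hfg.eq_of_nhds]
    ring
  have hW0 : ∀ s ∈ Ioo (-R) R, W s = 0 := fun s hs => by
    rw [← hWc]
    exact isOpen_Ioo.is_const_of_deriv_eq_zero isPreconnected_Ioo
      (fun x hx => (hWd x hx).differentiableAt.differentiableWithinAt)
      (fun x hx => (hWd x hx).deriv) hs hc
  have hwd : ∀ s ∈ Ioo (-R) R, HasDerivAt (fun x => g x / f x) 0 s := by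
    intro s hs
    have f1 := (hasDerivAt_and_hasDerivAt_deriv_of_contDiffOn_two isOpen_Ioo hf hs).1
    have g1 := (hasDerivAt_and_hasDerivAt_deriv_of_contDiffOn_two isOpen_Ioo hg hs).1
    have h0 : deriv g s * f s - g s * deriv f s = 0 :=
      (mul_eq_zero.mp (hW0 s hs)).resolve_left (pow_pos (hcos s hs) m).ne'
    have := g1.div f1 (hfpos s hs).ne'
    rwa [h0, zero_div] at this
  intro s hs
  have hcc : g c / f c = 1 := by
    rw [← hfg.eq_of_nhds]
    exact div_self (hfpos c hc).ne'
  rw [← hcc]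
  exact isOpen_Ioo.is_const_of_deriv_eq_zero isPreconnected_Ioo
    (fun x hx => (hwd x hx).differentiableAt.differentiableWithinAt)
    (fun x hx => (hwd x hx).deriv) hs hc

/-- Under the normalization
`∫₀^{D/2} φ̄₁² cos^{n−1} = ∫₀^{D/2} φ̄₂² cos^{n−1}` and the monotonicity of `φ̄₂/φ̄₁`,
there is a unique crossing point `b ∈ (0, D/2)` with `φ̄₁(b) = φ̄₂(b)`, and
`φ̄₂ ≤ φ̄₁` on `[0, b]`, `φ̄₂ ≥ φ̄₁` on `[b, D/2]`. -/
theorem model_eigenfunctions_cross_once (n : ℕ) (hn : 1 ≤ n) (D : ℝ)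
    (hD0 : 0 < D) (hDpi : D < π)
    (φ₁ φ₂ : ℝ → ℝ) (lam₁ lam₂ : ℝ)
    -- φ₁ : first model eigenfunction (even, positive on the open interval)
    (h₁cont : ContinuousOn φ₁ (Set.Icc (-(D/2)) (D/2)))
    (h₁smooth : ContDiffOn ℝ 2 φ₁ (Set.Ioo (-(D/2)) (D/2)))
    (h₁even : ∀ s ∈ Set.Icc (-(D/2)) (D/2), φ₁ (-s) = φ₁ s)
    (h₁pos : ∀ s ∈ Set.Ioo (-(D/2)) (D/2), 0 < φ₁ s)
    (h₁bd : φ₁ (D/2) = 0) (h₁bd' : φ₁ (-(D/2)) = 0)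
    (h₁ode : ∀ s ∈ Set.Ioo (-(D/2)) (D/2),
      deriv (deriv φ₁) s - ((n : ℝ) - 1) * Real.tan s * deriv φ₁ s + lam₁ * φ₁ s = 0)
    -- φ₂ : second model eigenfunction (odd, positive on (0, D/2))
    (h₂cont : ContinuousOn φ₂ (Set.Icc (-(D/2)) (D/2)))
    (h₂smooth : ContDiffOn ℝ 2 φ₂ (Set.Ioo (-(D/2)) (D/2)))
    (h₂odd : ∀ s ∈ Set.Icc (-(D/2)) (D/2), φ₂ (-s) = -φ₂ s)
    (h₂pos : ∀ s ∈ Set.Ioo 0 (D/2), 0 < φ₂ s)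
    (h₂bd : φ₂ (D/2) = 0) (h₂bd' : φ₂ (-(D/2)) = 0)
    (h₂ode : ∀ s ∈ Set.Ioo (-(D/2)) (D/2),
      deriv (deriv φ₂) s - ((n : ℝ) - 1) * Real.tan s * deriv φ₂ s + lam₂ * φ₂ s = 0)
    -- the quotient φ₂/φ₁ is monotone nondecreasing on [0, D/2)
    (hmono : MonotoneOn (fun s => φ₂ s / φ₁ s) (Set.Ico 0 (D/2)))
    -- normalization
    (hnorm : ∫ s in (0 : ℝ)..(D/2), φ₁ s ^ 2 * Real.cos s ^ (n-1)
           = ∫ s in (0 : ℝ)..(D/2), φ₂ s ^ 2 * Real.cos s ^ (n-1)) :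
    ∃ b ∈ Set.Ioo 0 (D/2), φ₁ b = φ₂ b ∧
      (∀ b' ∈ Set.Ioo 0 (D/2), φ₁ b' = φ₂ b' → b' = b) ∧
      (∀ s ∈ Set.Icc 0 b, φ₂ s ≤ φ₁ s) ∧
      (∀ s ∈ Set.Icc b (D/2), φ₁ s ≤ φ₂ s) := by
  obtain ⟨m, rfl⟩ : ∃ m, n = m + 1 := ⟨n - 1, by omega⟩
  simp only [Nat.cast_add, Nat.cast_one, add_sub_cancel_right] at h₁ode h₂ode
  simp only [Nat.add_sub_cancel] at hnorm
  set R := D / 2 with hRdef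
  have hR0 : 0 < R := by positivity
  have hRpi : R < π / 2 := by simp only [hRdef]; linarith
  have hsub : Ico 0 R ⊆ Ioo (-R) R := fun s hs => ⟨by linarith [hs.1], hs.2⟩
  have hpos : ∀ s ∈ Ico 0 R, 0 < φ₁ s := fun s hs => h₁pos s (hsub hs)
  have hz : φ₂ 0 = 0 := by
    have := h₂odd 0 ⟨by linarith, hR0.le⟩
    rw [neg_zero] at this
    linarith
  have hle_one : ∀ s ∈ Ico 0 R, φ₂ s / φ₁ s ≤ 1 ↔ φ₂ s ≤ φ₁ s := fun s hs =>
    div_le_one (hpos s hs)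
  have hone_le : ∀ s ∈ Ico 0 R, 1 ≤ φ₂ s / φ₁ s ↔ φ₁ s ≤ φ₂ s := fun s hs =>
    one_le_div (hpos s hs)
  have heq_one : ∀ s ∈ Ico 0 R, φ₂ s / φ₁ s = 1 ↔ φ₁ s = φ₂ s := fun s hs => by
    rw [div_eq_one_iff_eq (hpos s hs).ne', eq_comm]
  have hwcont : ContinuousOn (fun s => φ₂ s / φ₁ s) (Ico 0 R) :=
    (h₂smooth.continuousOn.mono hsub).div (h₁smooth.continuousOn.mono hsub)
      (fun s hs => (hpos s hs).ne')
  -- a point where the ratio is at least one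
  obtain ⟨c, hc, hwc⟩ : ∃ c ∈ Ioo 0 R, φ₁ c ≤ φ₂ c := by
    by_contra! hlt
    have hsub' : Icc 0 R ⊆ Icc (-R) R := Icc_subset_Icc_left (by linarith)
    have key : ∀ x ∈ Ioo 0 R, φ₂ x ^ 2 * Real.cos x ^ m < φ₁ x ^ 2 * Real.cos x ^ m := by
      intro x hx
      have hcos : 0 < Real.cos x :=
        Real.cos_pos_of_mem_Ioo ⟨by linarith [hx.1], by linarith [hx.2]⟩
      exact mul_lt_mul_of_pos_right
        (pow_lt_pow_left₀ (hlt x hx) (h₂pos x hx).le two_ne_zero) (pow_pos hcos m)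
    have hcosm : ContinuousOn (fun x => Real.cos x ^ m) (Icc 0 R) :=
      (Real.continuous_cos.pow m).continuousOn
    refine (intervalIntegral.integral_lt_integral_of_continuousOn_of_le_of_exists_lt hR0
      (((h₂cont.mono hsub').pow 2).mul hcosm) (((h₁cont.mono hsub').pow 2).mul hcosm)
      (fun x hx => ?_) ⟨R / 2, ⟨by linarith, by linarith⟩,
        key _ ⟨by linarith, by linarith⟩⟩).ne hnorm.symm
    rcases hx.2.eq_or_lt with h | h
    · simp [h, h₁bd, h₂bd]
    · exact (key x ⟨hx.1, h⟩).le
  obtain ⟨b, hb, hwb⟩ : ∃ b ∈ Icc 0 c, φ₂ b / φ₁ b = 1 := by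
    refine intermediate_value_Icc hc.1.le
      (hwcont.mono fun x hx => ⟨hx.1, hx.2.trans_lt hc.2⟩) ⟨?_, ?_⟩
    · simp [hz]
    · exact (hone_le c ⟨hc.1.le, hc.2⟩).mpr hwc
  have hb0 : 0 < b := by
    rcases hb.1.eq_or_lt with h | h
    · rw [← h, hz, zero_div] at hwb
      exact absurd hwb zero_ne_one
    · exact h
  have hbR : b < R := hb.2.trans_lt hc.2
  -- the ratio cannot equal one at two distinct points
  have huniq : ∀ x y, x ∈ Ioo 0 R → y ∈ Ioo 0 R → φ₁ x = φ₂ x → φ₁ y = φ₂ y → ¬ x < y := by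
    intro x y hx hy hx1 hy1 hxy
    have hloc : φ₁ =ᶠ[nhds ((x + y) / 2)] φ₂ := by
      filter_upwards [Ioo_mem_nhds (show x < (x + y) / 2 by linarith)
        (show (x + y) / 2 < y by linarith)] with t ht
      have htm : t ∈ Ico 0 R := ⟨by linarith [hx.1, ht.1], ht.2.trans hy.2⟩
      refine le_antisymm ((hone_le t htm).mp ?_) ((hle_one t htm).mp ?_)
      · rw [← (heq_one x ⟨hx.1.le, hx.2⟩).mpr hx1]
        exact hmono ⟨hx.1.le, hx.2⟩ htm ht.1.le
      · rw [← (heq_one y ⟨hy.1.le, hy.2⟩).mpr hy1]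
        exact hmono htm ⟨hy.1.le, hy.2⟩ ht.2.le
    have h0 := ratio_eq_one_of_eventuallyEq hRpi h₁smooth h₂smooth h₁pos h₁ode h₂ode
      (hsub ⟨by linarith [hx.1, hy.1], by linarith [hx.2, hy.2]⟩) hloc 0 (hsub ⟨le_rfl, hR0⟩)
    rw [hz, zero_div] at h0
    exact zero_ne_one h0
  have hbm : b ∈ Ico 0 R := ⟨hb0.le, hbR⟩
  have hb1 : φ₁ b = φ₂ b := (heq_one b hbm).mp hwb
  refine ⟨b, ⟨hb0, hbR⟩, hb1, fun b' hb' hb'1 => ?_, fun s hs => ?_, fun s hs => ?_⟩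
  · exact le_antisymm (not_lt.mp (huniq b b' ⟨hb0, hbR⟩ hb' hb1 hb'1))
      (not_lt.mp (huniq b' b hb' ⟨hb0, hbR⟩ hb'1 hb1))
  · have hsm : s ∈ Ico 0 R := ⟨hs.1, hs.2.trans_lt hbR⟩
    rw [← hle_one s hsm, ← hwb]
    exact hmono hsm hbm hs.2
  · rcases hs.2.eq_or_lt with h | h
    · rw [h, h₁bd, h₂bd]
    · have hsm : s ∈ Ico 0 R := ⟨hb0.le.trans hs.1, h⟩
      rw [← hone_le s hsm, ← hwb]
      exact hmono hbm hsm hs.1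
end
end

section
/- Let n ≥ 1 be an integer, 0 < D < π, and let m(s) = (1 + s·tan(s))/cos²(s). Let φ̄₁ be a first model eigenfunction on [−D/2, D/2] (even, positive on (−D/2, D/2)) and φ̄₂ a second model eigenfunction (odd, with φ̄₂ > 0 on (0, D/2)). Assume the quotient φ̄₂/φ̄₁ is monotone nondecreasing on [0, D/2), and assume the normalization ∫₀^{D/2} φ̄₁(s)² cos^{n−1}(s) ds = ∫₀^{D/2} φ̄₂(s)² cos^{n−1}(s) ds. Then ∫₀^{D/2} m(s)·(φ̄₂(s)² − φ̄₁(s)²)·cos^{n−1}(s) ds ≥ 0. -/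
open Real Set

noncomputable section

/-- Chebyshev-type inequality: if `f` has zero mean and changes sign at most once, from negative
to positive, then its integral against a monotone weight is nonnegative. -/
theorem intervalIntegral_mul_nonneg_of_single_crossing {a b : ℝ} (hab : a ≤ b) {m f : ℝ → ℝ}
    (hm : MonotoneOn m (Set.Icc a b)) (hmc : ContinuousOn m (Set.Icc a b))
    (hfc : ContinuousOn f (Set.Icc a b))
    (hf : ∀ s ∈ Set.Icc a b, ∀ t ∈ Set.Icc a b, s < t → 0 < f s → 0 ≤ f t)
    (h0 : ∫ s in a..b, f s = 0) : 0 ≤ ∫ s in a..b, m s * f s := by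
  set S : Set ℝ := insert b {s ∈ Set.Icc a b | 0 < f s} with hS
  have hSsub : S ⊆ Set.Icc a b := by
    rintro x (rfl | hx)
    · exact ⟨hab, le_rfl⟩
    · exact hx.1
  have hSne : S.Nonempty := ⟨b, Set.mem_insert _ _⟩
  have hSbdd : BddBelow S := ⟨a, fun x hx => (hSsub hx).1⟩
  set c := sInf S
  have hc : c ∈ Set.Icc a b :=
    ⟨le_csInf hSne fun x hx => (hSsub hx).1, csInf_le hSbdd (Set.mem_insert _ _)⟩
  have key : 0 ≤ ∫ s in a..b, (m s * f s - m c * f s) := by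
    refine intervalIntegral.integral_nonneg hab fun s hs => ?_
    rw [← sub_mul]
    rcases lt_trichotomy s c with h | h | h
    · have hfs : f s ≤ 0 := by
        by_contra! hpos
        exact absurd (csInf_le hSbdd (Set.mem_insert_of_mem _ ⟨hs, hpos⟩)) (not_le.mpr h)
      exact mul_nonneg_of_nonpos_of_nonpos (sub_nonpos.mpr (hm hs hc h.le)) hfs
    · simp [h]
    · obtain ⟨t, ht, hts⟩ := exists_lt_of_csInf_lt hSne h
      rcases ht with rfl | ht
      · exact absurd hs.2 (not_le.mpr hts)
      · exact mul_nonneg (sub_nonneg.mpr (hm hc hs h.le)) (hf t ht.1 s hs hts ht.2)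
  have hfi : IntervalIntegrable f MeasureTheory.volume a b :=
    hfc.intervalIntegrable_of_Icc hab
  have hmfi : IntervalIntegrable (fun s => m s * f s) MeasureTheory.volume a b :=
    (hmc.mul hfc).intervalIntegrable_of_Icc hab
  rwa [intervalIntegral.integral_sub hmfi (hfi.const_mul _), intervalIntegral.integral_const_mul,
    h0, mul_zero, sub_zero] at key

/-- The weight `(1 + s tan s) / cos² s` is monotone on `[0, π/2)`. -/
theorem monotoneOn_one_add_mul_tan_div_cos_sq :
    MonotoneOn (fun s : ℝ => (1 + s * Real.tan s) / Real.cos s ^ 2) (Set.Ico 0 (π / 2)) := by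
  intro s hs t ht hst
  have hct : 0 < Real.cos t := Real.cos_pos_of_mem_Ioo ⟨by linarith [ht.1, Real.pi_pos], ht.2⟩
  have hcos : Real.cos t ≤ Real.cos s :=
    Real.cos_le_cos_of_nonneg_of_le_pi hs.1 (by linarith [ht.2, Real.pi_pos]) hst
  have htan : Real.tan s ≤ Real.tan t := by
    refine Real.strictMonoOn_tan.monotoneOn ⟨?_, hs.2⟩ ⟨?_, ht.2⟩ hst
    · linarith [hs.1, Real.pi_pos]
    · linarith [ht.1, Real.pi_pos]
  have hs0 : 0 ≤ Real.tan s := Real.tan_nonneg_of_nonneg_of_le_pi_div_two hs.1 hs.2.le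
  have hmul : s * Real.tan s ≤ t * Real.tan t := mul_le_mul hst htan hs0 ht.1
  have hnn : 0 ≤ s * Real.tan s := mul_nonneg hs.1 hs0
  exact div_le_div₀ (by linarith) (by linarith) (by positivity) (by gcongr)

/-- The weight `(1 + s tan s) / cos² s` is continuous on `[0, π/2)`. -/
theorem continuousOn_one_add_mul_tan_div_cos_sq :
    ContinuousOn (fun s : ℝ => (1 + s * Real.tan s) / Real.cos s ^ 2) (Set.Ico 0 (π / 2)) := by
  have hcos : ∀ s ∈ Set.Ico (0 : ℝ) (π / 2), Real.cos s ≠ 0 := fun s hs =>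
    (Real.cos_pos_of_mem_Ioo ⟨by linarith [hs.1, Real.pi_pos], hs.2⟩).ne'
  have htan : ContinuousOn Real.tan (Set.Ico 0 (π / 2)) :=
    Real.continuousOn_tan.mono hcos
  exact (continuousOn_const.add (continuousOn_id.mul htan)).div
    (Real.continuous_cos.pow 2).continuousOn fun s hs => pow_ne_zero 2 (hcos s hs)

/-- With `m(s) = (1 + s·tan s)/cos² s`, under the normalization
`∫₀^{D/2} φ̄₁² cos^{n−1} = ∫₀^{D/2} φ̄₂² cos^{n−1}` and the monotonicity of `φ̄₂/φ̄₁`,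
one has `∫₀^{D/2} m(s)·(φ̄₂² − φ̄₁²)·cos^{n−1}(s) ds ≥ 0`. -/
theorem model_weighted_integral_nonneg (n : ℕ) (hn : 1 ≤ n) (D : ℝ)
    (hD0 : 0 < D) (hDpi : D < π)
    (φ₁ φ₂ : ℝ → ℝ) (lam₁ lam₂ : ℝ)
    -- φ₁ : first model eigenfunction (even, positive on the open interval)
    (h₁cont : ContinuousOn φ₁ (Set.Icc (-(D/2)) (D/2)))
    (h₁smooth : ContDiffOn ℝ 2 φ₁ (Set.Ioo (-(D/2)) (D/2)))
    (h₁even : ∀ s ∈ Set.Icc (-(D/2)) (D/2), φ₁ (-s) = φ₁ s)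
    (h₁pos : ∀ s ∈ Set.Ioo (-(D/2)) (D/2), 0 < φ₁ s)
    (h₁bd : φ₁ (D/2) = 0) (h₁bd' : φ₁ (-(D/2)) = 0)
    (h₁ode : ∀ s ∈ Set.Ioo (-(D/2)) (D/2),
      deriv (deriv φ₁) s - ((n : ℝ) - 1) * Real.tan s * deriv φ₁ s + lam₁ * φ₁ s = 0)
    -- φ₂ : second model eigenfunction (odd, positive on (0, D/2))
    (h₂cont : ContinuousOn φ₂ (Set.Icc (-(D/2)) (D/2)))
    (h₂smooth : ContDiffOn ℝ 2 φ₂ (Set.Ioo (-(D/2)) (D/2)))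
    (h₂odd : ∀ s ∈ Set.Icc (-(D/2)) (D/2), φ₂ (-s) = -φ₂ s)
    (h₂pos : ∀ s ∈ Set.Ioo 0 (D/2), 0 < φ₂ s)
    (h₂bd : φ₂ (D/2) = 0) (h₂bd' : φ₂ (-(D/2)) = 0)
    (h₂ode : ∀ s ∈ Set.Ioo (-(D/2)) (D/2),
      deriv (deriv φ₂) s - ((n : ℝ) - 1) * Real.tan s * deriv φ₂ s + lam₂ * φ₂ s = 0)
    -- the quotient φ₂/φ₁ is monotone nondecreasing on [0, D/2)
    (hmono : MonotoneOn (fun s => φ₂ s / φ₁ s) (Set.Ico 0 (D/2)))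
    -- normalization
    (hnorm : ∫ s in (0 : ℝ)..(D/2), φ₁ s ^ 2 * Real.cos s ^ (n-1)
           = ∫ s in (0 : ℝ)..(D/2), φ₂ s ^ 2 * Real.cos s ^ (n-1)) :
    (0 : ℝ) ≤ ∫ s in (0 : ℝ)..(D/2),
      (1 + s * Real.tan s) / Real.cos s ^ 2 * (φ₂ s ^ 2 - φ₁ s ^ 2) * Real.cos s ^ (n-1) := by
  have hb : 0 < D / 2 := by linarith
  have hbpi : D / 2 < π / 2 := by linarith
  have hsub : Set.Icc 0 (D / 2) ⊆ Set.Icc (-(D / 2)) (D / 2) :=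
    Set.Icc_subset_Icc_left (by linarith)
  have hsub' : Set.Icc 0 (D / 2) ⊆ Set.Ico 0 (π / 2) := fun s hs => ⟨hs.1, hs.2.trans_lt hbpi⟩
  have hcos : ∀ s ∈ Set.Icc 0 (D / 2), 0 < Real.cos s := fun s hs =>
    Real.cos_pos_of_mem_Ioo ⟨by linarith [hs.1, Real.pi_pos], (hsub' hs).2⟩
  have hcosc : ContinuousOn (fun s => Real.cos s ^ (n - 1)) (Set.Icc 0 (D / 2)) :=
    (Real.continuous_cos.pow _).continuousOn
  have hc₁ : ContinuousOn (fun s => φ₁ s ^ 2 * Real.cos s ^ (n - 1)) (Set.Icc 0 (D / 2)) :=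
    ((h₁cont.mono hsub).pow 2).mul hcosc
  have hc₂ : ContinuousOn (fun s => φ₂ s ^ 2 * Real.cos s ^ (n - 1)) (Set.Icc 0 (D / 2)) :=
    ((h₂cont.mono hsub).pow 2).mul hcosc
  have hφ₂ : ∀ s ∈ Set.Ico 0 (D / 2), 0 ≤ φ₂ s := by
    intro s hs
    rcases hs.1.eq_or_lt with rfl | h
    · have h0 := h₂odd 0 ⟨by linarith, hb.le⟩
      rw [neg_zero] at h0
      linarith
    · exact (h₂pos s ⟨h, hs.2⟩).le
  have key := intervalIntegral_mul_nonneg_of_single_crossing hb.le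
    (monotoneOn_one_add_mul_tan_div_cos_sq.mono hsub')
    (continuousOn_one_add_mul_tan_div_cos_sq.mono hsub')
    (f := fun s => (φ₂ s ^ 2 - φ₁ s ^ 2) * Real.cos s ^ (n - 1))
    ((((h₂cont.mono hsub).pow 2).sub ((h₁cont.mono hsub).pow 2)).mul hcosc) ?_ ?_
  · simpa only [mul_assoc] using key
  · intro s hs t ht hst hpos
    refine mul_nonneg ?_ (pow_pos (hcos t ht) _).le
    rcases ht.2.eq_or_lt with rfl | htb
    · simp [h₁bd, h₂bd]
    have hs' : s ∈ Set.Ico 0 (D / 2) := ⟨hs.1, hst.trans htb⟩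
    have ht' : t ∈ Set.Ico 0 (D / 2) := ⟨ht.1, htb⟩
    have h₁s : 0 < φ₁ s := h₁pos s ⟨by linarith [hs.1], hs'.2⟩
    have h₁t : 0 < φ₁ t := h₁pos t ⟨by linarith [ht.1], htb⟩
    have hsq : φ₁ s ^ 2 < φ₂ s ^ 2 :=
      sub_pos.mp (pos_of_mul_pos_left hpos (pow_pos (hcos s hs) _).le)
    have hlt : φ₁ s < φ₂ s := lt_of_pow_lt_pow_left₀ 2 (hφ₂ s hs') hsq
    have hquot : 1 ≤ φ₂ t / φ₁ t :=
      ((one_lt_div h₁s).mpr hlt).le.trans (hmono hs' ht' hst.le)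
    exact sub_nonneg.mpr (pow_le_pow_left₀ h₁t.le ((one_le_div h₁t).mp hquot) 2)
  · simp only [sub_mul]
    rw [intervalIntegral.integral_sub (hc₂.intervalIntegrable_of_Icc hb.le)
      (hc₁.intervalIntegrable_of_Icc hb.le), hnorm, sub_self]
end
end

section
/- Let Ω ⊂ ℝⁿ be a bounded, open, uniformly convex set, let 0 < T < ∞, and let u : closure(Ω) × [0,T] → ℝ be a function that, together with its first and second spatial derivatives, is continuous on closure(Ω) × [0,T], such that u > 0 on Ω × [0,T], u(x,t) = 0 for all x ∈ ∂Ω and t ∈ [0,T], and ∇u(x,t) ≠ 0 for all x ∈ ∂Ω and t ∈ [0,T]. Then: (i) there exists r₁ > 0 such that for every t ∈ [0,T] and every x ∈ Ω with dist(x, ∂Ω) < r₁, the Hessian of log u(·,t) at x is negative definite; and (ii) there exists N ∈ ℝ such that Hess(log u(·,t))(x)(v,v) ≤ N·‖v‖² for all x ∈ Ω, t ∈ [0,T], and v ∈ ℝⁿ. -/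
open Real Set

noncomputable section

abbrev Eu (n : ℕ) := EuclideanSpace ℝ (Fin n)

/-- Uniform convexity of a Euclidean domain: convex and there is `κ > 0` such that for
all `x, y ∈ closure Ω`, the closed ball of radius `κ·‖x−y‖²` centered at `(x+y)/2` is
contained in `closure Ω`. -/
def IsUniformlyConvexEuc {n : ℕ} (Ω : Set (Eu n)) : Prop :=
  Convex ℝ Ω ∧ ∃ κ : ℝ, 0 < κ ∧ ∀ x ∈ closure Ω, ∀ y ∈ closure Ω,
    Metric.closedBall (midpoint ℝ x y) (κ * ‖x - y‖ ^ 2) ⊆ closure Ω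

/-- The quadratic form `Hess v(x)(w,w)` of the Hessian of `v` at `x`. -/
def hessQ {n : ℕ} (v : Eu n → ℝ) (x w : Eu n) : ℝ :=
  fderiv ℝ (fun y => fderiv ℝ v y w) x w

/-- The numerator of the Hessian of `log f` at `x`, as a function of the direction `w`. -/
def logHessNum {E : Type*} [NormedAddCommGroup E] [NormedSpace ℝ E]
    (f : E → ℝ) (x w : E) : ℝ :=
  f x * fderiv ℝ (fderiv ℝ f) x w w - (fderiv ℝ f x w) ^ 2

lemma logHessNum_smul {E : Type*} [NormedAddCommGroup E] [NormedSpace ℝ E]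
    (f : E → ℝ) (x w : E) (c : ℝ) :
    logHessNum f x (c • w) = c ^ 2 * logHessNum f x w := by
  simp only [logHessNum, map_smul, _root_.smul_apply, smul_eq_mul]
  ring

lemma hessQ_log_eq {n : ℕ} {f : Eu n → ℝ} {x : Eu n} (hf : ContDiffAt ℝ 2 f x)
    (hx : 0 < f x) (w : Eu n) :
    hessQ (fun y => Real.log (f y)) x w = logHessNum f x w / (f x) ^ 2 := by
  have hev : (fun y => fderiv ℝ (fun z => Real.log (f z)) y w) =ᶠ[nhds x]
      fun y => (f y)⁻¹ * fderiv ℝ f y w := by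
    filter_upwards [hf.eventually (by simp), hf.continuousAt.eventually (lt_mem_nhds hx)]
      with y hy hy0
    have hd : HasFDerivAt f (fderiv ℝ f y) y :=
      (hy.differentiableAt (by norm_num)).hasFDerivAt
    rw [(hd.log hy0.ne').fderiv]
    simp
  have hd : HasFDerivAt f (fderiv ℝ f x) x :=
    (hf.differentiableAt (by norm_num)).hasFDerivAt
  have hd2 : HasFDerivAt (fderiv ℝ f) (fderiv ℝ (fderiv ℝ f) x) x :=
    ((hf.fderiv_right (m := 1) (by norm_num)).differentiableAt (by norm_num)).hasFDerivAt
  have hd3 : HasFDerivAt (fun y => fderiv ℝ f y w)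
      ((fderiv ℝ (fderiv ℝ f) x).flip w) x := by
    simpa using hd2.clm_apply (hasFDerivAt_const w x)
  have hinv : HasFDerivAt (fun y => (f y)⁻¹) (-((f x) ^ 2)⁻¹ • fderiv ℝ f x) x :=
    (hasDerivAt_inv hx.ne').comp_hasFDerivAt x hd
  rw [hessQ, hev.fderiv_eq, (hinv.fun_mul hd3).fderiv]
  simp only [logHessNum, _root_.add_apply, _root_.smul_apply,
    ContinuousLinearMap.flip_apply, smul_eq_mul]
  field_simp
  ring

/-- A function which is nonnegative on a convex set and vanishes at a point of it has
nonnegative derivative there in all directions pointing into the set. -/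
lemma Convex.fderiv_sub_nonneg {E : Type*} [NormedAddCommGroup E] [NormedSpace ℝ E]
    {s : Set E} (hs : Convex ℝ s) {f : E → ℝ} {x y : E} (hf : DifferentiableAt ℝ f x)
    (hx : x ∈ s) (hy : y ∈ s) (hnonneg : ∀ z ∈ s, 0 ≤ f z) (hfx : f x = 0) :
    0 ≤ fderiv ℝ f x (y - x) := by
  have hmin : IsLocalMinOn f s x :=
    Filter.eventually_of_mem self_mem_nhdsWithin fun z hz => by
      rw [hfx]; exact hnonneg z hz
  exact hmin.hasFDerivWithinAt_nonneg hf.hasFDerivAt.hasFDerivWithinAt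
    (sub_mem_posTangentConeAt_of_segment_subset (hs.segment_subset hx hy))

lemma IsPreconnected.inter_frontier_nonempty_of_isOpen {X : Type*} [TopologicalSpace X]
    {s t : Set X} (ht : IsPreconnected t) (hs : IsOpen s) (hin : (t ∩ s).Nonempty)
    (hout : (t ∩ sᶜ).Nonempty) : (t ∩ frontier s).Nonempty := by
  by_contra hcon
  have hmem : ∀ y ∈ t, y ∈ closure s → y ∈ s := fun y hy hyc => by
    by_contra hys
    exact hcon ⟨y, hy, by rw [hs.frontier_eq]; exact ⟨hyc, hys⟩⟩
  obtain ⟨z, hz, hzs⟩ := hout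
  obtain ⟨y, -, hys, hyc⟩ := ht s (closure s)ᶜ hs isClosed_closure.isOpen_compl
    (fun y hy => or_iff_not_imp_right.2 fun h => hmem y hy (not_not.1 h)) hin
    ⟨z, hz, fun h => hzs (hmem z hz h)⟩
  exact hyc (subset_closure hys)

lemma Filter.Tendsto.continuousLinearMap_apply {ι E F : Type*} [NormedAddCommGroup E]
    [NormedSpace ℝ E] [NormedAddCommGroup F] [NormedSpace ℝ F] {l : Filter ι}
    {g : ι → E →L[ℝ] F} {h : ι → E} {g₀ : E →L[ℝ] F} {h₀ : E}
    (hg : Filter.Tendsto g l (nhds g₀)) (hh : Filter.Tendsto h l (nhds h₀)) :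
    Filter.Tendsto (fun i => g i (h i)) l (nhds (g₀ h₀)) :=
  (isBoundedBilinearMap_apply (𝕜 := ℝ) (E := E) (F := F)).continuous.continuousAt.tendsto.comp
    (hg.prodMk_nhds hh)

/-- Two applications of the mean value theorem along a segment at whose endpoints `f` vanishes. -/
lemma exists_fderiv_eq_zero_and_fderiv_fderiv_le {E : Type*} [NormedAddCommGroup E]
    [NormedSpace ℝ E] {f : E → ℝ} {x d : E} {s : ℝ} (hs : 0 < s)
    (hf : ∀ r ∈ Set.Icc 0 s, ContDiffAt ℝ 2 f (x + r • d))
    (h0 : f x = 0) (h1 : f (x + s • d) = 0) (hd : 0 ≤ fderiv ℝ f x d) :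
    ∃ r ∈ Set.Icc 0 s, ∃ ρ ∈ Set.Icc 0 s, fderiv ℝ f (x + r • d) d = 0 ∧
      s * fderiv ℝ (fderiv ℝ f) (x + ρ • d) d d ≤ -fderiv ℝ f x d := by
  have hline : ∀ r : ℝ, HasDerivAt (fun r : ℝ => x + r • d) d r := fun r => by
    simpa using ((hasDerivAt_id r).smul_const d).const_add x
  have hφ : ∀ r ∈ Set.Icc 0 s,
      HasDerivAt (fun r : ℝ => f (x + r • d)) (fderiv ℝ f (x + r • d) d) r := fun r hr =>
    (((hf r hr).differentiableAt (by norm_num)).hasFDerivAt).comp_hasDerivAt r (hline r)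
  have hφ' : ∀ r ∈ Set.Icc 0 s, HasDerivAt (fun r : ℝ => fderiv ℝ f (x + r • d) d)
      (fderiv ℝ (fderiv ℝ f) (x + r • d) d d) r := fun r hr => by
    have h2 : HasFDerivAt (fderiv ℝ f) (fderiv ℝ (fderiv ℝ f) (x + r • d)) (x + r • d) :=
      (((hf r hr).fderiv_right (m := 1) (by norm_num)).differentiableAt
        (by norm_num)).hasFDerivAt
    have h3 : HasFDerivAt (fun y => fderiv ℝ f y d)
        ((fderiv ℝ (fderiv ℝ f) (x + r • d)).flip d) (x + r • d) := by
      simpa using h2.clm_apply (hasFDerivAt_const d _)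
    exact h3.comp_hasDerivAt r (hline r)
  obtain ⟨r, hr, hr0⟩ := exists_hasDerivAt_eq_zero
    (f := fun r : ℝ => f (x + r • d)) (f' := fun r => fderiv ℝ f (x + r • d) d) hs
    (fun r hr => (hφ r hr).continuousAt.continuousWithinAt) (by simp [h0, h1])
    (fun r hr => hφ r (Set.Ioo_subset_Icc_self hr))
  have hsub : Set.Icc 0 r ⊆ Set.Icc 0 s := Set.Icc_subset_Icc_right hr.2.le
  obtain ⟨ρ, hρ, hρ0⟩ := exists_hasDerivAt_eq_slope
    (fun r : ℝ => fderiv ℝ f (x + r • d) d)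
    (fun r => fderiv ℝ (fderiv ℝ f) (x + r • d) d d) hr.1
    (fun r hr => (hφ' r (hsub hr)).continuousAt.continuousWithinAt)
    (fun r hr => hφ' r (hsub (Set.Ioo_subset_Icc_self hr)))
  refine ⟨r, Set.Ioo_subset_Icc_self hr, ρ, hsub (Set.Ioo_subset_Icc_self hρ), hr0, ?_⟩
  rw [hρ0, hr0, zero_smul, add_zero, sub_zero, zero_sub, ← mul_div_assoc,
    div_le_iff₀ hr.1]
  nlinarith [mul_nonneg hd (sub_nonneg.2 hr.2.le)]

/-- In a uniformly convex set, the supporting functional given by the derivative of a defining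
function grows quadratically. -/
lemma sq_le_fderiv_sub_of_uniformlyConvex {n : ℕ} {Ω : Set (Eu n)} (hΩ : Convex ℝ Ω) {κ : ℝ}
    (hκ : 0 < κ)
    (hball : ∀ x ∈ closure Ω, ∀ y ∈ closure Ω,
      Metric.closedBall (midpoint ℝ x y) (κ * ‖x - y‖ ^ 2) ⊆ closure Ω)
    {f : Eu n → ℝ} {x : Eu n} (hf : DifferentiableAt ℝ f x) (hx : x ∈ closure Ω)
    (hnonneg : ∀ z ∈ closure Ω, 0 ≤ f z) (hfx : f x = 0) (hgrad : fderiv ℝ f x ≠ 0) :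
    ∃ c > 0, ∀ y ∈ closure Ω, c * ‖y - x‖ ^ 2 ≤ fderiv ℝ f x (y - x) := by
  obtain ⟨v, hv⟩ : ∃ v, fderiv ℝ f x v ≠ 0 := by
    by_contra! h
    exact hgrad (ContinuousLinearMap.ext h)
  obtain ⟨v, hv, hv1⟩ : ∃ v, 0 < fderiv ℝ f x v ∧ ‖v‖ ≤ 1 := by
    have hv0 : v ≠ 0 := fun h => hv (by simp [h])
    refine ⟨((SignType.sign (fderiv ℝ f x v) : ℝ) * ‖v‖⁻¹) • v, ?_, ?_⟩
    · have := norm_pos_iff.2 hv0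
      rw [map_smul, smul_eq_mul, mul_right_comm, sign_mul_self]
      positivity
    · rw [norm_smul, norm_mul, norm_inv, norm_norm, mul_assoc,
        inv_mul_cancel₀ (norm_ne_zero_iff.2 hv0), mul_one]
      rcases lt_or_gt_of_ne hv with h | h <;> simp [h]
  refine ⟨2 * κ * fderiv ℝ f x v, by positivity, fun y hy => ?_⟩
  have hmem : midpoint ℝ x y - (κ * ‖x - y‖ ^ 2) • v ∈ closure Ω := by
    refine hball x hx y hy ?_
    rw [Metric.mem_closedBall, dist_eq_norm, sub_sub_cancel_left, norm_neg, norm_smul,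
      Real.norm_of_nonneg (by positivity)]
    exact mul_le_of_le_one_right (by positivity) hv1
  have key := hΩ.closure.fderiv_sub_nonneg hf hx hmem hnonneg hfx
  have heq : midpoint ℝ x y - (κ * ‖x - y‖ ^ 2) • v - x
      = (1 / 2 : ℝ) • (y - x) - (κ * ‖y - x‖ ^ 2) • v := by
    rw [midpoint_eq_smul_add, norm_sub_rev, invOf_eq_inv]
    module
  rw [heq, map_sub, map_smul, map_smul, smul_eq_mul, smul_eq_mul] at key
  linarith

/-- A function positive inside a uniformly convex set, vanishing on the boundary with nonzero
gradient, is strictly concave at boundary points in tangential directions. -/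
lemma fderiv_fderiv_neg_of_tangent {n : ℕ} {Ω : Set (Eu n)} (hopen : IsOpen Ω)
    (hne : Ω.Nonempty) (hconv : IsUniformlyConvexEuc Ω) {f : Eu n → ℝ}
    (hf : ∀ x ∈ closure Ω, ContDiffAt ℝ 2 f x) (hpos : ∀ x ∈ Ω, 0 < f x)
    (hbd : ∀ x ∈ frontier Ω, f x = 0) {x : Eu n} (hx : x ∈ frontier Ω)
    (hgrad : fderiv ℝ f x ≠ 0) {w : Eu n} (hw : w ≠ 0) (hLw : fderiv ℝ f x w = 0) :
    fderiv ℝ (fderiv ℝ f) x w w < 0 := by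
  obtain ⟨hΩ, κ, hκ, hball⟩ := hconv
  have hxc : x ∈ closure Ω := frontier_subset_closure hx
  have hnonneg : ∀ z ∈ closure Ω, 0 ≤ f z := fun z hz => by
    by_cases h : z ∈ Ω
    · exact (hpos z h).le
    · exact (hbd z (by rw [hopen.frontier_eq]; exact ⟨hz, h⟩)).ge
  obtain ⟨c, hc, hquad⟩ := sq_le_fderiv_sub_of_uniformlyConvex hΩ hκ hball
    ((hf x hxc).differentiableAt (by norm_num)) hxc hnonneg (hbd x hx) hgrad
  obtain ⟨p, hp⟩ := hne
  have hxΩ : x ∉ Ω := by rw [hopen.frontier_eq] at hx; exact hx.2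
  have hLq : 0 < fderiv ℝ f x (p - x) := by
    have hpx : p - x ≠ 0 := sub_ne_zero.2 fun h => hxΩ (h ▸ hp)
    have := norm_pos_iff.2 hpx
    exact lt_of_lt_of_le (by positivity) (hquad p (subset_closure hp))
  have hstep : ∀ s : ℝ, 0 < s → s < 1 → ∃ l ∈ Set.Icc (0 : ℝ) 1, ∃ r ∈ Set.Icc 0 s,
      ∃ ρ ∈ Set.Icc 0 s,
      fderiv ℝ f (x + r • (w + l • (p - x - w))) (w + l • (p - x - w)) = 0 ∧
      fderiv ℝ (fderiv ℝ f) (x + ρ • (w + l • (p - x - w))) (w + l • (p - x - w))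
        (w + l • (p - x - w)) ≤ -c * ‖w + l • (p - x - w)‖ ^ 2 := by
    intro s hs hs1
    have hout : x + s • w ∉ Ω := fun h => by
      have h1 := hquad _ (subset_closure h)
      have := norm_pos_iff.2 hw
      rw [add_sub_cancel_left, map_smul, hLw, smul_zero, norm_smul,
        Real.norm_of_nonneg hs.le] at h1
      exact absurd h1 (not_le.2 (by positivity))
    have hin : x + s • (p - x) ∈ Ω := by
      have := hΩ.add_smul_sub_mem_interior' hxc (hopen.interior_eq.symm ▸ hp) ⟨hs, hs1.le⟩
      rwa [hopen.interior_eq] at this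
    obtain ⟨y, hy, hyf⟩ := (convex_segment (𝕜 := ℝ) (x + s • w)
      (x + s • (p - x))).isPreconnected.inter_frontier_nonempty_of_isOpen hopen ⟨_, right_mem_segment ℝ _ _, hin⟩ ⟨_, left_mem_segment ℝ _ _, hout⟩
    rw [segment_eq_image'] at hy
    obtain ⟨l, hl, rfl⟩ := hy
    have hyd : x + s • w + l • (x + s • (p - x) - (x + s • w))
        = x + s • (w + l • (p - x - w)) := by module
    simp only [hyd] at hyf
    set d := w + l • (p - x - w) with hd
    have hyc := frontier_subset_closure hyf
    have hq := hquad _ hyc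
    rw [add_sub_cancel_left, map_smul, smul_eq_mul, norm_smul,
      Real.norm_of_nonneg hs.le] at hq
    have hq' : s * (c * ‖d‖ ^ 2) ≤ fderiv ℝ f x d := by
      refine le_of_mul_le_mul_left (le_trans (le_of_eq ?_) hq) hs
      ring
    have hseg : ∀ r ∈ Set.Icc 0 s, x + r • d ∈ closure Ω := fun r hr => by
      have := hΩ.closure.add_smul_mem hxc hyc
        (t := r / s) ⟨div_nonneg hr.1 hs.le, (div_le_one hs).2 hr.2⟩
      rwa [smul_smul, div_mul_cancel₀ _ hs.ne'] at this
    obtain ⟨r, hr, ρ, hρ, h1, h2⟩ := exists_fderiv_eq_zero_and_fderiv_fderiv_le hs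
      (fun r hr => hf _ (hseg r hr)) (hbd x hx) (hbd _ hyf)
      (le_trans (by positivity) hq')
    refine ⟨l, hl, r, hr, ρ, hρ, h1, le_of_mul_le_mul_left ?_ hs⟩
    linarith
  have hs0 : ∀ k : ℕ, (0 : ℝ) < 1 / ((k : ℝ) + 2) := fun k => by positivity
  have hs1 : ∀ k : ℕ, 1 / ((k : ℝ) + 2) < 1 := fun k => by
    rw [div_lt_one (by positivity)]
    linarith [(Nat.cast_nonneg k : (0 : ℝ) ≤ k)]
  choose l hl r hr ρ hρ hzero hle using fun k : ℕ => hstep _ (hs0 k) (hs1 k)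
  obtain ⟨l₀, -, φ, hφ, hlim⟩ := isCompact_Icc.tendsto_subseq hl
  have hslim : Filter.Tendsto (fun k : ℕ => 1 / ((k : ℝ) + 2)) Filter.atTop (nhds 0) := by
    exact tendsto_const_nhds.div_atTop
      (Filter.tendsto_atTop_add_const_right _ (2 : ℝ) tendsto_natCast_atTop_atTop)
  have hrlim : Filter.Tendsto (r ∘ φ) Filter.atTop (nhds 0) :=
    (squeeze_zero (fun k => (hr k).1) (fun k => (hr k).2) hslim).comp hφ.tendsto_atTop
  have hρlim : Filter.Tendsto (ρ ∘ φ) Filter.atTop (nhds 0) :=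
    (squeeze_zero (fun k => (hρ k).1) (fun k => (hρ k).2) hslim).comp hφ.tendsto_atTop
  have hdlim : Filter.Tendsto (fun k => w + l (φ k) • (p - x - w)) Filter.atTop
      (nhds (w + l₀ • (p - x - w))) :=
    tendsto_const_nhds.add (hlim.smul_const _)
  have hpt : ∀ {a : ℕ → ℝ}, Filter.Tendsto a Filter.atTop (nhds 0) →
      Filter.Tendsto (fun k => x + a k • (w + l (φ k) • (p - x - w))) Filter.atTop (nhds x) :=
    fun ha => by simpa using (ha.smul hdlim).const_add x
  have hC1 : ContDiffAt ℝ 1 (fderiv ℝ f) x := (hf x hxc).fderiv_right (by norm_num)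
  have hC0 : ContinuousAt (fderiv ℝ (fderiv ℝ f)) x :=
    (hC1.fderiv_right (m := 0) (by norm_num)).continuousAt
  have hl0 : l₀ = 0 := by
    have h1 := Filter.Tendsto.continuousLinearMap_apply
      (hC1.continuousAt.tendsto.comp (hpt hrlim)) hdlim
    have h2 : fderiv ℝ f x (w + l₀ • (p - x - w)) = 0 :=
      tendsto_nhds_unique h1 (tendsto_const_nhds.congr fun k => (hzero (φ k)).symm)
    rw [map_add, map_smul, map_sub _ (p - x), hLw, sub_zero, zero_add, smul_eq_mul] at h2
    exact (mul_eq_zero.1 h2).resolve_right hLq.ne'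
  subst hl0
  rw [zero_smul, add_zero] at hdlim
  have h1 := Filter.Tendsto.continuousLinearMap_apply
    (Filter.Tendsto.continuousLinearMap_apply (hC0.tendsto.comp (hpt hρlim)) hdlim) hdlim
  have h2 := le_of_tendsto_of_tendsto' h1 ((hdlim.norm.pow 2).const_mul (-c))
    fun k => hle (φ k)
  have := norm_pos_iff.2 hw
  have : 0 < c * ‖w‖ ^ 2 := by positivity
  linarith

/-- For a bounded, open, uniformly convex `Ω ⊂ ℝⁿ` and a function `u`
positive in `Ω × [0,T]`, vanishing on `∂Ω × [0,T]` with nonvanishing spatial gradient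
there, and C² in space with `u`, `∇u`, `Hess u` continuous on `closure Ω × [0,T]`:
(i) the Hessian of `log u(·,t)` is negative definite at interior points within
distance `r₁` of the boundary, for some `r₁ > 0`; and (ii) it is bounded above by
`N‖v‖²` on all of `Ω × [0,T]`, for some `N`. -/
theorem hessian_log_near_boundary (n : ℕ) (Ω : Set (Eu n))
    (hΩopen : IsOpen Ω) (hΩbdd : Bornology.IsBounded Ω) (hΩne : Ω.Nonempty)
    (hconv : IsUniformlyConvexEuc Ω)
    (T : ℝ) (hT0 : 0 < T)
    (u : Eu n → ℝ → ℝ)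
    (hu_smooth : ∀ t ∈ Set.Icc (0:ℝ) T, ∀ x ∈ closure Ω, ContDiffAt ℝ 2 (fun y => u y t) x)
    (hu_cont : ContinuousOn (fun p : Eu n × ℝ => u p.1 p.2) (closure Ω ×ˢ Set.Icc (0:ℝ) T))
    (hgrad_cont : ContinuousOn (fun p : Eu n × ℝ => fderiv ℝ (fun y => u y p.2) p.1)
      (closure Ω ×ˢ Set.Icc (0:ℝ) T))
    (hhess_cont : ContinuousOn
      (fun p : Eu n × ℝ => fderiv ℝ (fun y => fderiv ℝ (fun z => u z p.2) y) p.1)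
      (closure Ω ×ˢ Set.Icc (0:ℝ) T))
    (hpos : ∀ t ∈ Set.Icc (0:ℝ) T, ∀ x ∈ Ω, 0 < u x t)
    (hbd : ∀ t ∈ Set.Icc (0:ℝ) T, ∀ x ∈ frontier Ω, u x t = 0)
    (hgrad_ne : ∀ t ∈ Set.Icc (0:ℝ) T, ∀ x ∈ frontier Ω,
      fderiv ℝ (fun y => u y t) x ≠ 0) :
    (∃ r₁ : ℝ, 0 < r₁ ∧ ∀ t ∈ Set.Icc (0:ℝ) T, ∀ x ∈ Ω,
      Metric.infDist x (frontier Ω) < r₁ →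
        ∀ w : Eu n, w ≠ 0 → hessQ (fun y => Real.log (u y t)) x w < 0) ∧
    (∃ N : ℝ, ∀ t ∈ Set.Icc (0:ℝ) T, ∀ x ∈ Ω, ∀ w : Eu n,
      hessQ (fun y => Real.log (u y t)) x w ≤ N * ‖w‖ ^ 2) := by
  have hcpt : IsCompact (closure Ω) := hΩbdd.isCompact_closure
  have hsphere : IsCompact (Metric.sphere (0 : Eu n) 1) := isCompact_sphere 0 1
  set K : Set ((Eu n × ℝ) × Eu n) :=
    (closure Ω ×ˢ Set.Icc (0:ℝ) T) ×ˢ Metric.sphere (0 : Eu n) 1 with hK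
  have hKc : IsCompact K := (hcpt.prod isCompact_Icc).prod hsphere
  have hfst : Set.MapsTo (Prod.fst : (Eu n × ℝ) × Eu n → Eu n × ℝ) K
      (closure Ω ×ˢ Set.Icc (0:ℝ) T) := fun q hq => hq.1
  have hcU : ContinuousOn (fun q : (Eu n × ℝ) × Eu n => u q.1.1 q.1.2) K :=
    hu_cont.comp continuousOn_fst hfst
  have hcD : ContinuousOn
      (fun q : (Eu n × ℝ) × Eu n => fderiv ℝ (fun y => u y q.1.2) q.1.1 q.2) K :=
    (hgrad_cont.comp continuousOn_fst hfst).clm_apply continuousOn_snd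
  have hcH : ContinuousOn (fun q : (Eu n × ℝ) × Eu n =>
      fderiv ℝ (fderiv ℝ (fun z => u z q.1.2)) q.1.1 q.2 q.2) K :=
    ((hhess_cont.comp continuousOn_fst hfst).clm_apply continuousOn_snd).clm_apply
      continuousOn_snd
  have hnear : ∃ r₁ : ℝ, 0 < r₁ ∧ ∀ t ∈ Set.Icc (0:ℝ) T, ∀ x ∈ Ω,
      Metric.infDist x (frontier Ω) < r₁ → ∀ w : Eu n, ‖w‖ = 1 →
        logHessNum (fun y => u y t) x w < 0 := by
    by_contra! hcon
    choose t ht x hx hdist w hw hge using fun k : ℕ =>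
      hcon (1 / ((k : ℝ) + 1)) (by positivity)
    have hmem : ∀ k, ((x k, t k), w k) ∈ K := fun k =>
      ⟨⟨subset_closure (hx k), ht k⟩, by simp [hw k]⟩
    obtain ⟨⟨⟨x₀, t₀⟩, w₀⟩, hq₀, φ, hφ, hlim⟩ := hKc.tendsto_subseq hmem
    have hlimK := tendsto_nhdsWithin_iff.2
      ⟨hlim, Filter.Eventually.of_forall fun k => hmem (φ k)⟩
    have hU := (hcU _ hq₀).tendsto.comp hlimK
    have hD := (hcD _ hq₀).tendsto.comp hlimK
    have hH := (hcH _ hq₀).tendsto.comp hlimK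
    have hw₀ : ‖w₀‖ = 1 := by simpa using hq₀.2
    have hw0 : w₀ ≠ 0 := fun h => by simp [h] at hw₀
    have : Nontrivial (Eu n) := ⟨w₀, 0, hw0⟩
    have hfne : (frontier Ω).Nonempty := by
      refine nonempty_frontier_iff.2 ⟨hΩne, fun h => ?_⟩
      exact NormedSpace.unbounded_univ ℝ (Eu n) (h ▸ hΩbdd)
    have hxlim : Filter.Tendsto (fun k => x (φ k)) Filter.atTop (nhds x₀) :=
      (continuous_fst.comp continuous_fst).continuousAt.tendsto.comp hlim
    have hx₀ : x₀ ∈ frontier Ω := by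
      rw [isClosed_frontier.mem_iff_infDist_zero hfne]
      refine tendsto_nhds_unique
        ((Metric.continuous_infDist_pt _).continuousAt.tendsto.comp hxlim) ?_
      exact (squeeze_zero (fun k => Metric.infDist_nonneg) (fun k => (hdist k).le)
        tendsto_one_div_add_atTop_nhds_zero_nat).comp hφ.tendsto_atTop
    have ht₀ : t₀ ∈ Set.Icc (0:ℝ) T := hq₀.1.2
    have hge' : ∀ k, (fderiv ℝ (fun y => u y (t k)) (x k) (w k)) ^ 2 ≤
        u (x k) (t k) * fderiv ℝ (fderiv ℝ (fun y => u y (t k))) (x k) (w k) (w k) :=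
      fun k => sub_nonneg.1 (hge k)
    have hDz : fderiv ℝ (fun y => u y t₀) x₀ w₀ = 0 := by
      have h := le_of_tendsto_of_tendsto' (hD.pow 2) (hU.mul hH) fun k => hge' (φ k)
      simp only [hbd t₀ ht₀ x₀ hx₀, zero_mul] at h
      exact pow_eq_zero_iff two_ne_zero |>.1 (le_antisymm h (sq_nonneg _))
    have hHn : 0 ≤ fderiv ℝ (fderiv ℝ (fun y => u y t₀)) x₀ w₀ w₀ :=
      ge_of_tendsto' hH fun k => nonneg_of_mul_nonneg_right
        ((sq_nonneg _).trans (hge' (φ k))) (hpos _ (ht _) _ (hx _))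
    exact absurd hHn (not_le.2 (fderiv_fderiv_neg_of_tangent hΩopen hΩne hconv
      (hu_smooth t₀ ht₀) (hpos t₀ ht₀) (hbd t₀ ht₀) hx₀ (hgrad_ne t₀ ht₀ x₀ hx₀) hw0 hDz))
  obtain ⟨r₁, hr₁, hneg⟩ := hnear
  have hscale : ∀ t ∈ Set.Icc (0:ℝ) T, ∀ x ∈ Ω, ∀ w : Eu n,
      hessQ (fun y => Real.log (u y t)) x w =
        ‖w‖ ^ 2 * (logHessNum (fun y => u y t) x (‖w‖⁻¹ • w) / (u x t) ^ 2) := by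
    intro t ht x hx w
    rw [hessQ_log_eq (hu_smooth t ht x (subset_closure hx)) (hpos t ht x hx),
      ← mul_div_assoc, ← logHessNum_smul]
    rcases eq_or_ne w 0 with rfl | hw
    · simp
    · rw [smul_smul, mul_inv_cancel₀ (norm_ne_zero_iff.2 hw), one_smul]
  have hunit : ∀ w : Eu n, w ≠ 0 → ‖‖w‖⁻¹ • w‖ = 1 := fun w hw => by
    rw [norm_smul, norm_inv, norm_norm, inv_mul_cancel₀ (norm_ne_zero_iff.2 hw)]
  have hnearlog : ∀ t ∈ Set.Icc (0:ℝ) T, ∀ x ∈ Ω, Metric.infDist x (frontier Ω) < r₁ →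
      ∀ w : Eu n, w ≠ 0 → hessQ (fun y => Real.log (u y t)) x w < 0 := by
    intro t ht x hx hd w hw
    have h1 := norm_pos_iff.2 hw
    have h2 := hpos t ht x hx
    rw [hscale t ht x hx]
    exact mul_neg_of_pos_of_neg (by positivity)
      (div_neg_of_neg_of_pos (hneg t ht x hx hd _ (hunit w hw)) (by positivity))
  refine ⟨⟨r₁, hr₁, hnearlog⟩, ?_⟩
  set K' : Set ((Eu n × ℝ) × Eu n) :=
    K ∩ {q | r₁ ≤ Metric.infDist q.1.1 (frontier Ω)} with hK'
  have hK'c : IsCompact K' := hKc.inter_right <| isClosed_le continuous_const <|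
    (Metric.continuous_infDist_pt _).comp (continuous_fst.comp continuous_fst)
  have hK'pos : ∀ q ∈ K', u q.1.1 q.1.2 ≠ 0 := by
    rintro q ⟨hq, hq'⟩
    refine (hpos _ hq.1.2 _ ?_).ne'
    by_contra hn
    have hfr : q.1.1 ∈ frontier Ω := by rw [hΩopen.frontier_eq]; exact ⟨hq.1.1, hn⟩
    have hq'' : r₁ ≤ Metric.infDist q.1.1 (frontier Ω) := hq'
    rw [Metric.infDist_zero_of_mem hfr] at hq''
    linarith
  have hcF : ContinuousOn (fun q : (Eu n × ℝ) × Eu n =>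
      logHessNum (fun y => u y q.1.2) q.1.1 q.2 / (u q.1.1 q.1.2) ^ 2) K' :=
    (((hcU.mul hcH).sub (hcD.pow 2)).mono Set.inter_subset_left).div
      ((hcU.mono Set.inter_subset_left).pow 2) fun q hq => pow_ne_zero 2 (hK'pos q hq)
  obtain ⟨C, hC⟩ := hK'c.exists_bound_of_continuousOn hcF
  refine ⟨max C 0, fun t ht x hx w => ?_⟩
  rcases eq_or_ne w 0 with rfl | hw
  · simp [hessQ]
  rcases lt_or_ge (Metric.infDist x (frontier Ω)) r₁ with hd | hd
  · exact (hnearlog t ht x hx hd w hw).le.trans (by positivity)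
  · rw [hscale t ht x hx, mul_comm]
    refine mul_le_mul_of_nonneg_right ?_ (by positivity)
    exact (le_abs_self _).trans ((hC ((x, t), ‖w‖⁻¹ • w)
      ⟨⟨⟨subset_closure hx, ht⟩, by simpa using hunit w hw⟩, hd⟩).trans (le_max_left _ _))
end
end
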